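/- Let A⁽¹⁾, A⁽²⁾ ∈ ℂ^{n×n} be independent samples from the trace-normalised complex Wishart–Laguerre ensemble with parameters n, m, and for s = 1, 2 let λ₁⁽ˢ⁾ ≥ … ≥ λ_n⁽ˢ⁾ ≥ 0 denote the eigenvalues of A⁽ˢ⁾ in decreasing order. Let P_{n,m} denote the probability that λ_k⁽¹⁾ + λ_{k+1}⁽¹⁾ + … + λ_n⁽¹⁾ ≤ λ_k⁽²⁾ + λ_{k+1}⁽²⁾ + … + λ_n⁽²⁾ holds for every k with 1 ≤ k ≤ n. Then P_{n,m} → 0 as n, m → ∞; that is, for every ε > 0 there exists N such that P_{n,m} ≤ ε whenever n ≥ N and m ≥ N. -/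

import Mathlib

open MeasureTheory ProbabilityTheory Filter Topology

noncomputable section

instance {n m α : Type*} [MeasurableSpace α] : MeasurableSpace (Matrix n m α) :=
  inferInstanceAs (MeasurableSpace (n → m → α))

/-- Standard complex Gaussian: `Z = X + iY` with `X, Y` independent real Gaussians of mean 0
and variance 1/2, so that `E[|Z|²] = 1`. -/
def stdCGaussian : Measure ℂ :=
  ((gaussianReal 0 (1/2)).prod (gaussianReal 0 (1/2))).map
    (fun p : ℝ × ℝ => (p.1 : ℂ) + p.2 * Complex.I)

/-- The law of an `n × m` matrix with i.i.d. standard complex Gaussian entries. -/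
def gaussMatrix (n m : ℕ) : Measure (Matrix (Fin n) (Fin m) ℂ) :=
  Measure.pi fun _ : Fin n => Measure.pi fun _ : Fin m => stdCGaussian

/-- The complex Wishart--Laguerre ensemble with parameters `n, m`: the law of `G Gᴴ` where
`G` is an `n × m` matrix with i.i.d. standard complex Gaussian entries. -/
def wishart (n m : ℕ) : Measure (Matrix (Fin n) (Fin n) ℂ) :=
  (gaussMatrix n m).map fun G => G * G.conjTranspose

/-- The trace-normalised complex Wishart--Laguerre ensemble: the law of `M / tr M` where `M`
is sampled from the complex Wishart--Laguerre ensemble. -/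
def wishartNorm (n m : ℕ) : Measure (Matrix (Fin n) (Fin n) ℂ) :=
  (wishart n m).map fun M => (Matrix.trace M)⁻¹ • M

/-- The (real) eigenvalues of a Hermitian matrix (junk value `0` if not Hermitian). -/
def eigs {n : ℕ} (M : Matrix (Fin n) (Fin n) ℂ) : Fin n → ℝ :=
  if h : M.IsHermitian then h.eigenvalues else 0

/-- The decreasing rearrangement of a tuple of reals. -/
def sortDesc {n : ℕ} (v : Fin n → ℝ) : Fin n → ℝ :=
  fun i => v (Tuple.sort v i.rev)

/-- `tailSum v k = v k + v (k+1) + ... + v (n-1)` (so with `v` sorted decreasingly and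
`k` the 0-indexed version of the 1-indexed index in the paper, this is `λ_k + ... + λ_n`). -/
def tailSum {n : ℕ} (v : Fin n → ℝ) (k : Fin n) : ℝ :=
  ∑ i ∈ Finset.univ.filter (fun i => k ≤ i), v i

/-- The eigenvalues of `M`, sorted in decreasing order. -/
def eigsDesc {n : ℕ} (M : Matrix (Fin n) (Fin n) ℂ) : Fin n → ℝ := sortDesc (eigs M)


open Finset.HasAntidiagonal (antidiagonal)

lemma integrable_pow_gaussianReal (k : ℕ) : Integrable (fun x : ℝ => x ^ k)
    (gaussianReal 0 (1/2)) := by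
  rcases Nat.eq_zero_or_pos k with rfl | hk
  · simp
  · have h := memLp_id_gaussianReal' (μ := 0) (v := 1/2) (k : ENNReal) (by simp)
    replace h := h.integrable_norm_pow hk.ne'
    rw [← integrable_norm_iff (by fun_prop)]
    simpa using h

lemma integral_gaussian_half (f : ℝ → ℝ) :
    ∫ x, f x ∂gaussianReal 0 (1/2) = ∫ x, gaussianPDFReal 0 (1/2) x * f x := by
  rw [integral_gaussianReal_eq_integral_smul (by norm_num)]
  simp

lemma integrable_pow_mul_gaussianPDFReal (k : ℕ) :
    Integrable (fun x : ℝ => x ^ k * gaussianPDFReal 0 (1/2) x) := by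
  have h := integrable_pow_gaussianReal k
  rw [gaussianReal_of_var_ne_zero _ (by norm_num),
    integrable_withDensity_iff (by fun_prop) (by simp [gaussianPDF])] at h
  simpa using h

lemma hasDerivAt_gaussianPDFReal_half (x : ℝ) :
    HasDerivAt (gaussianPDFReal 0 (1/2)) (-2 * x * gaussianPDFReal 0 (1/2) x) x := by
  have h : gaussianPDFReal 0 (1/2) = fun x => (√(2 * Real.pi * (1/2)))⁻¹ * Real.exp (-x ^ 2) := by
    ext x; simp [gaussianPDFReal]
  rw [h]
  have h2 : HasDerivAt (fun x : ℝ => -x ^ 2) (-(2 * x)) x := by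
    simpa using (hasDerivAt_pow 2 x).fun_neg
  exact (h2.exp.const_mul ((√(2 * Real.pi * (1/2)))⁻¹)).congr_deriv (by ring)

/-- Integration by parts for monomials against the real Gaussian of variance `1/2`. -/
lemma integral_pow_succ_gaussianReal (k : ℕ) :
    ∫ x, x ^ (k + 1) ∂gaussianReal 0 (1/2) = (k / 2) * ∫ x, x ^ (k - 1) ∂gaussianReal 0 (1/2) := by
  have hd : ∀ x : ℝ, HasDerivAt (fun x => x ^ k * gaussianPDFReal 0 (1/2) x)
      (k * (x ^ (k - 1) * gaussianPDFReal 0 (1/2) x)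
        - 2 * (x ^ (k + 1) * gaussianPDFReal 0 (1/2) x)) x := fun x => by
    exact ((hasDerivAt_pow k x).mul (hasDerivAt_gaussianPDFReal_half x)).congr_deriv (by ring)
  have h1 := (integrable_pow_mul_gaussianPDFReal (k - 1)).const_mul (k : ℝ)
  have h2 := (integrable_pow_mul_gaussianPDFReal (k + 1)).const_mul (2 : ℝ)
  have h := integral_eq_zero_of_hasDerivAt_of_integrable hd (h1.sub h2)
    (integrable_pow_mul_gaussianPDFReal k)
  rw [integral_sub h1 h2, integral_const_mul, integral_const_mul] at h
  rw [integral_gaussian_half, integral_gaussian_half]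
  simp only [mul_comm (gaussianPDFReal 0 (1/2) _)]
  linarith

instance : IsProbabilityMeasure stdCGaussian :=
  Measure.isProbabilityMeasure_map (by fun_prop)

lemma integrable_re_pow_mul_im_pow (a b : ℕ) :
    Integrable (fun z : ℂ => ((z.re ^ a * z.im ^ b : ℝ) : ℂ)) stdCGaussian := by
  rw [stdCGaussian, integrable_map_measure (by fun_prop) (by fun_prop)]
  simpa [Function.comp_def] using
    ((integrable_pow_gaussianReal a).mul_prod (integrable_pow_gaussianReal b)).ofReal (𝕜 := ℂ)

lemma integral_re_pow_mul_im_pow (a b : ℕ) :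
    ∫ z : ℂ, ((z.re ^ a * z.im ^ b : ℝ) : ℂ) ∂stdCGaussian
      = ((∫ x, x ^ a ∂gaussianReal 0 (1/2)) * ∫ x, x ^ b ∂gaussianReal 0 (1/2) : ℝ) := by
  rw [stdCGaussian, integral_map (by fun_prop) (by fun_prop), integral_complex_ofReal,
    ← integral_prod_mul]
  simp

instance (n m : ℕ) : IsProbabilityMeasure (gaussMatrix n m) :=
  inferInstanceAs (IsProbabilityMeasure
    (Measure.pi fun _ : Fin n => Measure.pi fun _ : Fin m => stdCGaussian))

/-- Index set of the real coordinates of a complex `n × m` matrix: `false` marks real parts and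
`true` imaginary parts. -/
abbrev CoordIdx (n m : ℕ) : Type := (Fin n × Fin m) × Bool

/-- The real coordinates of a complex matrix. -/
def coord {n m : ℕ} (G : Matrix (Fin n) (Fin m) ℂ) (s : CoordIdx n m) : ℝ :=
  if s.2 then (G s.1.1 s.1.2).im else (G s.1.1 s.1.2).re

/-- Evaluation of a polynomial in the real coordinates at a complex matrix. -/
def coordEval {n m : ℕ} (G : Matrix (Fin n) (Fin m) ℂ) : MvPolynomial (CoordIdx n m) ℂ →ₐ[ℂ] ℂ :=
  MvPolynomial.aeval fun s => (coord G s : ℂ)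

lemma coordEval_monomial {n m : ℕ} (G : Matrix (Fin n) (Fin m) ℂ) (e : CoordIdx n m →₀ ℕ) (c : ℂ) :
    coordEval G (MvPolynomial.monomial e c) = c * ∏ i, ∏ j,
      (((G i j).re ^ e ((i, j), false) * (G i j).im ^ e ((i, j), true) : ℝ) : ℂ) := by
  rw [coordEval, MvPolynomial.aeval_monomial, Finsupp.prod_fintype _ _ (by simp),
    Fintype.prod_prod_type, Fintype.prod_prod_type]
  simp [coord, mul_comm]

lemma integrable_coordEval {n m : ℕ} (P : MvPolynomial (CoordIdx n m) ℂ) :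
    Integrable (fun G => coordEval G P) (gaussMatrix n m) := by
  induction P using MvPolynomial.induction_on' with
  | add P Q hP hQ =>
    simp only [map_add]
    exact hP.add hQ
  | monomial e c =>
    simp only [coordEval_monomial]
    refine Integrable.const_mul ?_ c
    exact Integrable.fintype_prod (f := fun i (v : Fin m → ℂ) => ∏ j,
      (((v j).re ^ e ((i, j), false) * (v j).im ^ e ((i, j), true) : ℝ) : ℂ)) fun i =>
        Integrable.fintype_prod (f := fun j (z : ℂ) =>
          ((z.re ^ e ((i, j), false) * z.im ^ e ((i, j), true) : ℝ) : ℂ)) fun j =>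
            integrable_re_pow_mul_im_pow _ _

/-- The expectation of a polynomial in the real coordinates of a Gaussian matrix. -/
def expect (n m : ℕ) : MvPolynomial (CoordIdx n m) ℂ →ₗ[ℂ] ℂ where
  toFun P := ∫ G, coordEval G P ∂gaussMatrix n m
  map_add' P Q := by
    simp only [map_add]
    exact integral_add (integrable_coordEval P) (integrable_coordEval Q)
  map_smul' c P := by
    simp only [map_smul, smul_eq_mul, RingHom.id_apply]
    exact integral_const_mul _ _

lemma expect_apply {n m : ℕ} (P : MvPolynomial (CoordIdx n m) ℂ) :
    expect n m P = ∫ G, coordEval G P ∂gaussMatrix n m := rfl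

lemma expect_monomial {n m : ℕ} (e : CoordIdx n m →₀ ℕ) (c : ℂ) :
    expect n m (MvPolynomial.monomial e c)
      = c * ∏ s, ((∫ x, x ^ e s ∂gaussianReal 0 (1/2) : ℝ) : ℂ) := by
  rw [expect_apply]
  simp only [coordEval_monomial]
  rw [integral_const_mul]
  congr 1
  rw [Fintype.prod_prod_type, Fintype.prod_prod_type]
  rw [gaussMatrix]
  refine (integral_fintype_prod_eq_prod (f := fun i (v : Fin m → ℂ) => ∏ j,
      (((v j).re ^ e ((i, j), false) * (v j).im ^ e ((i, j), true) : ℝ) : ℂ))).trans ?_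
  refine Finset.prod_congr rfl fun i _ => ?_
  refine (integral_fintype_prod_eq_prod (f := fun j (z : ℂ) =>
      ((z.re ^ e ((i, j), false) * z.im ^ e ((i, j), true) : ℝ) : ℂ))).trans ?_
  refine Finset.prod_congr rfl fun j _ => ?_
  rw [integral_re_pow_mul_im_pow]
  simp [mul_comm]

/-- Gaussian integration by parts in a real coordinate. -/
lemma expect_X_mul {n m : ℕ} (s : CoordIdx n m) (P : MvPolynomial (CoordIdx n m) ℂ) :
    expect n m (MvPolynomial.X s * P) = (1 / 2) * expect n m (MvPolynomial.pderiv s P) := by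
  induction P using MvPolynomial.induction_on' with
  | add P Q hP hQ => simp only [mul_add, map_add, hP, hQ]
  | monomial e c =>
    rw [MvPolynomial.pderiv_monomial, MvPolynomial.X, MvPolynomial.monomial_mul, expect_monomial,
      expect_monomial, ← Finset.mul_prod_erase _ _ (Finset.mem_univ s),
      ← Finset.mul_prod_erase _ _ (Finset.mem_univ s)]
    have h : ∀ t ∈ Finset.univ.erase s,
        ((∫ x, x ^ (Finsupp.single s 1 + e : CoordIdx n m →₀ ℕ) t ∂gaussianReal 0 (1/2) : ℝ) : ℂ)
          = ((∫ x, x ^ (e - Finsupp.single s 1 : CoordIdx n m →₀ ℕ) t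
              ∂gaussianReal 0 (1/2) : ℝ) : ℂ) := by
      intro t ht
      have : s ≠ t := (Finset.ne_of_mem_erase ht).symm
      simp [Finsupp.single_eq_of_ne' this]
    rw [Finset.prod_congr rfl h]
    simp only [Finsupp.coe_add, Pi.add_apply, Finsupp.single_eq_same, Finsupp.coe_tsub,
      Pi.sub_apply, add_comm 1 (e s), integral_pow_succ_gaussianReal]
    push_cast
    ring

/-- The rescaled Chebyshev polynomials of the second kind, shifted by one and evaluated at `b`:
`chebU b (k + 1) = S_k(b)`. -/
def chebU {A : Type*} [Ring A] (b : A) : ℕ → A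
  | 0 => 0
  | 1 => 1
  | k + 2 => b * chebU b (k + 1) - chebU b k

section ChebU

variable {A B : Type*} [Ring A] [Ring B] (b : A)

@[simp] lemma chebU_zero : chebU b 0 = 0 := rfl

@[simp] lemma chebU_one : chebU b 1 = 1 := rfl

lemma chebU_add_two (k : ℕ) : chebU b (k + 2) = b * chebU b (k + 1) - chebU b k := rfl

lemma map_chebU (f : A →+* B) (k : ℕ) : f (chebU b k) = chebU (f b) k := by
  induction k using Nat.twoStepInduction with
  | zero => simp
  | one => simp
  | more k h1 h2 => simp [chebU_add_two, h1, h2]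

lemma commute_chebU {c : A} (h : Commute c b) (k : ℕ) : Commute c (chebU b k) := by
  induction k using Nat.twoStepInduction with
  | zero => simp
  | one => simp
  | more k h1 h2 => exact (h.mul_right h2).sub_right h1

lemma mul_chebU_succ (k : ℕ) : b * chebU b (k + 1) = chebU b (k + 2) + chebU b k := by
  simp [chebU_add_two]

/-- The noncommutative divided difference of `chebU`. -/
def chebDiff (d : A) (k : ℕ) : A :=
  ∑ p ∈ antidiagonal k, chebU b p.1 * d * chebU b p.2

lemma chebDiff_add_two (d : A) (k : ℕ) :
    chebDiff b d (k + 2) = d * chebU b (k + 1) + b * chebDiff b d (k + 1) - chebDiff b d k := by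
  simp only [chebDiff]
  rw [Finset.Nat.sum_antidiagonal_succ, Finset.Nat.sum_antidiagonal_succ,
    Finset.Nat.sum_antidiagonal_succ (n := k)]
  simp only [chebU_zero, zero_mul, zero_add, chebU_one, one_mul, chebU_add_two, sub_mul,
    Finset.sum_sub_distrib, Finset.mul_sum, mul_assoc]
  abel

lemma apply_chebU (D : A →+ A) (hD : ∀ x y, D (x * y) = D x * y + x * D y) (k : ℕ) :
    D (chebU b k) = chebDiff b (D b) k := by
  have h1 : D 1 = 0 := by simpa using hD 1 1
  induction k using Nat.twoStepInduction with
  | zero => simp [chebDiff]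
  | one => simp [chebDiff, Finset.Nat.antidiagonal_succ, h1]
  | more k ih1 ih2 =>
    rw [chebDiff_add_two, chebU_add_two, map_sub, hD, ih1, ih2]

lemma chebDiff_one_sub (k : ℕ) :
    chebDiff b 1 (k + 2) - chebDiff b 1 k = ((k : A) + 1) * chebU b (k + 1) := by
  induction k using Nat.twoStepInduction with
  | zero => simp [chebDiff, Finset.Nat.antidiagonal_succ]
  | one =>
    simp [chebDiff, Finset.Nat.antidiagonal_succ, chebU_add_two]
    noncomm_ring
  | more k ih1 ih2 =>
    have e1 : chebDiff b 1 (k + 2 + 2) - chebDiff b 1 (k + 2)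
        = chebU b (k + 3) - chebU b (k + 1)
          + b * (chebDiff b 1 (k + 1 + 2) - chebDiff b 1 (k + 1))
          - (chebDiff b 1 (k + 2) - chebDiff b 1 k) := by
      rw [chebDiff_add_two b 1 (k + 2), chebDiff_add_two b 1 k]
      simp only [one_mul, mul_sub]
      abel
    rw [e1, ih1, ih2, ← mul_assoc]
    have e2 : b * (((k + 1 : ℕ) : A) + 1) = (((k + 1 : ℕ) : A) + 1) * b :=
      ((Nat.cast_commute _ b).add_left (Commute.one_left b)).symm.eq
    rw [e2, mul_assoc, mul_chebU_succ]
    push_cast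
    noncomm_ring

end ChebU

section SchwingerDyson

open Matrix MvPolynomial

variable {n m : ℕ}

/-- The matrix of formal Gaussian entries. -/
def formalG (n m : ℕ) : Matrix (Fin n) (Fin m) (MvPolynomial (CoordIdx n m) ℂ) :=
  .of fun i j => X ((i, j), false) + Complex.I • X ((i, j), true)

/-- The conjugate transpose of `formalG`. -/
def formalGH (n m : ℕ) : Matrix (Fin m) (Fin n) (MvPolynomial (CoordIdx n m) ℂ) :=
  .of fun j i => X ((i, j), false) - Complex.I • X ((i, j), true)

/-- The Wirtinger derivative with respect to the conjugate of the entry `(i, j)`. -/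
def wirtinger (i : Fin n) (j : Fin m) :
    Derivation ℂ (MvPolynomial (CoordIdx n m) ℂ) (MvPolynomial (CoordIdx n m) ℂ) :=
  (1 / 2 : ℂ) • (pderiv ((i, j), false) + Complex.I • pderiv ((i, j), true))

lemma expect_formalG_mul (i : Fin n) (j : Fin m) (P : MvPolynomial (CoordIdx n m) ℂ) :
    expect n m (formalG n m i j * P) = expect n m (wirtinger i j P) := by
  simp only [formalG, of_apply, add_mul, map_add, expect_X_mul, smul_mul_assoc, map_smul,
    wirtinger, Derivation.smul_apply, Derivation.add_apply, smul_eq_mul]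
  ring

lemma half_smul_add_I_smul_I_smul (x : MvPolynomial (CoordIdx n m) ℂ) :
    (1 / 2 : ℂ) • (x + Complex.I • Complex.I • x) = 0 := by
  simp [smul_smul]

lemma half_smul_sub_I_smul_I_smul (x : MvPolynomial (CoordIdx n m) ℂ) :
    (1 / 2 : ℂ) • (x - Complex.I • Complex.I • x) = x := by
  rw [smul_smul, Complex.I_mul_I, neg_one_smul, sub_neg_eq_add, ← two_smul ℂ, smul_smul]
  norm_num

lemma wirtinger_formalG (i i' : Fin n) (j j' : Fin m) :
    wirtinger i j (formalG n m i' j') = 0 := by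
  by_cases h : i = i' ∧ j = j'
  · obtain ⟨rfl, rfl⟩ := h
    simpa [formalG, wirtinger, pderiv_X, Pi.single_apply] using
      half_smul_add_I_smul_I_smul (n := n) (m := m) 1
  · have : ∀ b : Bool, ((i', j'), b) ≠ ((i, j), b) := fun b e => h (by simp_all)
    simp [formalG, wirtinger, pderiv_X, this]

lemma wirtinger_formalGH (i i' : Fin n) (j j' : Fin m) :
    wirtinger i j (formalGH n m j' i')
      = single j i (1 : MvPolynomial (CoordIdx n m) ℂ) j' i' := by
  by_cases h : i = i' ∧ j = j'
  · obtain ⟨rfl, rfl⟩ := h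
    simpa [formalGH, wirtinger, pderiv_X, Pi.single_apply, sub_eq_add_neg] using
      half_smul_sub_I_smul_I_smul (n := n) (m := m) 1
  · have h1 : ∀ b : Bool, ((i', j'), b) ≠ ((i, j), b) := fun b e => h (by simp_all)
    have h2 : ¬(j = j' ∧ i = i') := fun e => h e.symm
    simp [formalGH, wirtinger, pderiv_X, h1, single, h2]

lemma map_mul_of_derivation {R l p q : Type*} [Fintype p] [CommRing R] [Algebra ℂ R]
    (D : Derivation ℂ R R) (M : Matrix l p R) (N : Matrix p q R) :
    (M * N).map D = M.map D * N + M * N.map D := by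
  ext i j
  simp only [map_apply, mul_apply, map_sum, Derivation.leibniz, smul_eq_mul, Matrix.add_apply,
    Finset.sum_add_distrib]
  rw [add_comm]
  simp [mul_comm]

/-- The affine image `a • G Gᴴ - b` of the formal Wishart matrix. -/
def formalB (n m : ℕ) (a b : ℂ) : Matrix (Fin n) (Fin n) (MvPolynomial (CoordIdx n m) ℂ) :=
  a • (formalG n m * formalGH n m) - b • 1

lemma map_formalB {D : Derivation ℂ (MvPolynomial (CoordIdx n m) ℂ) (MvPolynomial (CoordIdx n m) ℂ)}
    (hD : ∀ i j, D (formalG n m i j) = 0) (a b : ℂ) :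
    (formalB n m a b).map D = a • (formalG n m * (formalGH n m).map D) := by
  have h1 : (formalG n m).map D = 0 := by
    ext; simp [hD]
  have h3 : (1 : Matrix (Fin n) (Fin n) (MvPolynomial (CoordIdx n m) ℂ)).map D = 0 := by
    ext1 p q
    by_cases h : p = q <;> simp [one_apply, h]
  rw [formalB, Matrix.map_sub _ (map_sub _), Matrix.map_smul _ _ (fun x => D.map_smul _ x),
    Matrix.map_smul _ _ (fun x => D.map_smul _ x), map_mul_of_derivation, h1, h3]
  simp

lemma map_chebU_formalB
    {D : Derivation ℂ (MvPolynomial (CoordIdx n m) ℂ) (MvPolynomial (CoordIdx n m) ℂ)}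
    (hD : ∀ i j, D (formalG n m i j) = 0) (a b : ℂ) (k : ℕ) :
    (chebU (formalB n m a b) k).map D
      = chebDiff (formalB n m a b) (a • (formalG n m * (formalGH n m).map D)) k := by
  rw [← map_formalB hD a b]
  exact apply_chebU (formalB n m a b) (AddMonoidHom.mapMatrix D.toLinearMap.toAddMonoidHom)
    (map_mul_of_derivation D) k

/-- The derivation along the vector field `U_k(B) G`. -/
def fieldDeriv (n m : ℕ) (a b : ℂ) (k : ℕ) :
    Derivation ℂ (MvPolynomial (CoordIdx n m) ℂ) (MvPolynomial (CoordIdx n m) ℂ) :=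
  ∑ i, ∑ j, (formalGH n m * chebU (formalB n m a b) k) j i • wirtinger i j

lemma fieldDeriv_apply (a b : ℂ) (k : ℕ) (P : MvPolynomial (CoordIdx n m) ℂ) :
    fieldDeriv n m a b k P
      = ∑ i, ∑ j, (formalGH n m * chebU (formalB n m a b) k) j i * wirtinger i j P := by
  have h : ∀ {ι : Type} (s : Finset ι)
      (f : ι → Derivation ℂ (MvPolynomial (CoordIdx n m) ℂ) (MvPolynomial (CoordIdx n m) ℂ)),
      (∑ i ∈ s, f i) P = ∑ i ∈ s, f i P := fun s f =>
    map_sum ({ toFun := fun D => D P, map_zero' := rfl, map_add' := fun _ _ => rfl } :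
      Derivation ℂ (MvPolynomial (CoordIdx n m) ℂ) (MvPolynomial (CoordIdx n m) ℂ)
        →+ MvPolynomial (CoordIdx n m) ℂ) f s
  simp [fieldDeriv, h]

/-- The Schwinger--Dyson equation for Chebyshev traces of a Wishart matrix. -/
theorem schwinger_dyson (a b : ℂ) (k : ℕ) (F : MvPolynomial (CoordIdx n m) ℂ) :
    expect n m (trace (formalG n m * formalGH n m * chebU (formalB n m a b) k) * F)
      = expect n m ((m : MvPolynomial (CoordIdx n m) ℂ) * trace (chebU (formalB n m a b) k) * F
        + (a • ∑ p ∈ antidiagonal k,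
          trace (formalG n m * formalGH n m * chebU (formalB n m a b) p.1)
            * trace (chebU (formalB n m a b) p.2)) * F
        + fieldDeriv n m a b k F) := by
  set U := chebU (formalB n m a b) with hU
  have h1 : trace (formalG n m * formalGH n m * U k) * F
      = ∑ i, ∑ j, formalG n m i j * ((formalGH n m * U k) j i * F) := by
    rw [Matrix.mul_assoc, trace, Finset.sum_mul]
    refine Finset.sum_congr rfl fun i _ => ?_
    rw [diag_apply, mul_apply, Finset.sum_mul]
    exact Finset.sum_congr rfl fun j _ => mul_assoc _ _ _
  have h2 : ∀ i j, wirtinger i j ((formalGH n m * U k) j i) = U k i i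
      + a • ∑ p ∈ antidiagonal k, (formalGH n m * (U p.1 * formalG n m)) j j * U p.2 i i := by
    intro i j
    have h3 : (formalGH n m).map (wirtinger i j) = single j i 1 := by
      ext1; simp [wirtinger_formalGH]
    have h4 := congrFun₂ (map_mul_of_derivation (wirtinger i j) (formalGH n m) (U k)) j i
    rw [map_apply] at h4
    rw [h4, Matrix.add_apply, h3, hU, map_chebU_formalB (wirtinger_formalG i · j ·), ← hU, h3]
    congr 1
    · simp
    · simp only [chebDiff, Matrix.mul_sum, Matrix.sum_apply, Finset.smul_sum, ← hU]
      refine Finset.sum_congr rfl fun p _ => ?_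
      have : formalGH n m * (U p.1 *
            (a • (formalG n m * single j i (1 : MvPolynomial (CoordIdx n m) ℂ))) * U p.2)
          = a • (formalGH n m * (U p.1 * formalG n m) *
            single j i (1 : MvPolynomial (CoordIdx n m) ℂ) * U p.2) := by
        simp [Matrix.mul_assoc]
      rw [this, Matrix.smul_apply, Matrix.mul_assoc _ (single j i 1), mul_apply,
        Finset.sum_eq_single j]
      · simp
      · intro c _ hc
        simp [hc]
      · simp
  rw [h1]
  simp only [map_sum, expect_formalG_mul, Derivation.leibniz, smul_eq_mul]
  simp only [← map_sum]
  congr 1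
  rw [fieldDeriv_apply]
  simp only [Finset.sum_add_distrib, h2]
  rw [add_comm]
  congr 1
  rw [← add_mul]
  simp only [mul_comm F, ← Finset.sum_mul]
  congr 1
  simp only [Finset.sum_add_distrib]
  congr 1
  · simp [trace, Finset.mul_sum]
  · simp only [← Finset.smul_sum]
    congr 1
    simp only [Finset.sum_comm (s := Finset.univ) (t := antidiagonal k)]
    refine Finset.sum_congr rfl fun p _ => ?_
    have h5 : trace (formalG n m * formalGH n m * U p.1)
        = trace (formalGH n m * (U p.1 * formalG n m)) := by
      rw [Matrix.mul_assoc, trace_mul_comm, Matrix.mul_assoc]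
    rw [h5, mul_comm, trace, trace, Finset.sum_mul_sum]
    exact Finset.sum_congr rfl fun i _ => Finset.sum_congr rfl fun j _ => mul_comm _ _

lemma fieldDeriv_trace (a b : ℂ) (k l : ℕ) :
    fieldDeriv n m a b k (trace (chebU (formalB n m a b) (l + 2))
        - trace (chebU (formalB n m a b) l))
      = (l + 1) * a • trace (formalG n m * formalGH n m *
          (chebU (formalB n m a b) k * chebU (formalB n m a b) (l + 1))) := by
  set B := formalB n m a b with hB
  set V := a • (formalG n m * formalGH n m * chebU B k) with hV
  have hD : ∀ i j, fieldDeriv n m a b k (formalG n m i j) = 0 := fun i j => by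
    simp [fieldDeriv_apply, wirtinger_formalG]
  have h1 : (formalGH n m).map (fieldDeriv n m a b k) = formalGH n m * chebU B k := by
    ext1 i j
    rw [map_apply, fieldDeriv_apply]
    simp only [wirtinger_formalGH]
    rw [Finset.sum_eq_single j, Finset.sum_eq_single i]
    · simp [hB]
    · intro c _ hc
      simp [hc]
    · simp
    · intro c _ hc
      simp [hc]
    · simp
  have hc : Commute B V := by
    have h2 : Commute B (formalG n m * formalGH n m) := by
      rw [hB, formalB]
      exact (((Commute.refl _).smul_left a).sub_left ((Commute.one_left _).smul_left b))
    exact (h2.mul_right (commute_chebU B (Commute.refl B) k)).smul_right a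
  have h2 : ∀ l, fieldDeriv n m a b k (trace (chebU B l)) = trace (V * chebDiff B 1 l) := by
    intro l
    have h3 := map_chebU_formalB hD a b l
    rw [h1, ← hB, ← Matrix.mul_assoc, ← hV] at h3
    have h4 : chebDiff B V l = V * chebDiff B 1 l := by
      simp only [chebDiff, Finset.mul_sum, mul_one, ← mul_assoc]
      refine Finset.sum_congr rfl fun p _ => ?_
      rw [(commute_chebU B hc.symm p.1).eq]
    rw [← h4, ← h3]
    simp [trace]
  rw [map_sub, h2, h2, ← trace_sub, ← mul_sub, chebDiff_one_sub, hV]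
  have : a • (formalG n m * formalGH n m * chebU B k) * (((l : Matrix _ _ _) + 1) * chebU B (l + 1))
      = ((l : MvPolynomial (CoordIdx n m) ℂ) + 1) • a • (formalG n m * formalGH n m *
          (chebU B k * chebU B (l + 1))) := by
    have : ((l : Matrix (Fin n) (Fin n) (MvPolynomial (CoordIdx n m) ℂ)) + 1)
      = ((l : MvPolynomial (CoordIdx n m) ℂ) + 1) • 1 := by
      rw [add_smul, one_smul, Nat.cast_smul_eq_nsmul]
      simp
    rw [this]
    simp [mul_assoc]
  rw [this, trace_smul, trace_smul, smul_eq_mul]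

end SchwingerDyson

section Sequences

variable {A B : Type*} [CommRing A] [CommRing B] (r h : A) (y : ℕ → A)

/-- Centred traces of the `chebU` in terms of the differences `y`. -/
def chebZ : ℕ → A
  | 0 => 0
  | 1 => 0
  | k + 2 => y (k + 1) + chebZ k

/-- Centred traces of `(1 + r² + r b) * chebU b a`. -/
def weightedZ : ℕ → A
  | 0 => 0
  | a + 1 => (1 + r ^ 2) * chebZ y (a + 1) + r * (chebZ y (a + 2) + chebZ y a)

/-- Centred traces of `(1 + r² + r b) * chebU b k * chebU b l`. -/
def weightedZ₂ : ℕ → ℕ → A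
  | 0, _ => 0
  | 1, l => weightedZ r y l
  | _ + 2, 0 => 0
  | k + 2, l + 1 => weightedZ₂ (k + 1) (l + 2) + weightedZ₂ (k + 1) l - weightedZ₂ k (l + 1)

/-- Carré du champ of `y k` and `y l`, suitably normalised. -/
def carre (k l : ℕ) : A := l * ((if k = l then 1 else 0) + h * weightedZ₂ r y k l)

/-- The derivation with values `D l` on `y l`, applied to a product of `y`s. -/
def listDeriv (D : ℕ → A) : List ℕ → A
  | [] => 0
  | l :: L => D l * (L.map y).prod + y l * listDeriv D L

/-- Limiting means of normalised traces of `chebU`. -/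
def chebMean : ℕ → A
  | 0 => 0
  | k + 1 => (-r) ^ k

lemma map_chebZ (f : A →+* B) (k : ℕ) : f (chebZ y k) = chebZ (fun i => f (y i)) k := by
  induction k using Nat.twoStepInduction with
  | zero => simp [chebZ]
  | one => simp [chebZ]
  | more k h1 h2 => simp [chebZ, h1]

lemma map_weightedZ (f : A →+* B) (k : ℕ) :
    f (weightedZ r y k) = weightedZ (f r) (fun i => f (y i)) k := by
  cases k <;> simp [weightedZ, map_chebZ]

lemma map_weightedZ₂ (f : A →+* B) (k l : ℕ) :
    f (weightedZ₂ r y k l) = weightedZ₂ (f r) (fun i => f (y i)) k l := by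
  induction k using Nat.twoStepInduction generalizing l with
  | zero => simp [weightedZ₂]
  | one => simp [weightedZ₂, map_weightedZ]
  | more k h1 h2 => cases l <;> simp [weightedZ₂, h1, h2]

lemma map_carre (f : A →+* B) (k l : ℕ) :
    f (carre r h y k l) = carre (f r) (f h) (fun i => f (y i)) k l := by
  simp [carre, map_weightedZ₂, apply_ite f]

lemma map_listDeriv (f : A →+* B) (D : ℕ → A) (L : List ℕ) :
    f (listDeriv y D L) = listDeriv (fun i => f (y i)) (fun i => f (D i)) L := by
  induction L with
  | nil => simp [listDeriv]
  | cons l L ih => simp [listDeriv, ih, map_list_prod, Function.comp_def]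

lemma derivation_list_prod [Algebra B A] (D : Derivation B A A) (L : List ℕ) :
    D (L.map y).prod = listDeriv y (fun i => D (y i)) L := by
  induction L with
  | nil => simp [listDeriv]
  | cons l L ih =>
    simp only [List.map_cons, List.prod_cons, Derivation.leibniz, smul_eq_mul, ih, listDeriv]
    ring

lemma mul_listDeriv (c : A) (D : ℕ → A) (L : List ℕ) :
    c * listDeriv y D L = listDeriv y (fun i => c * D i) L := by
  induction L with
  | nil => simp [listDeriv]
  | cons l L ih =>
    simp only [listDeriv, mul_add, ← ih]
    ring

lemma sum_weightedZ_mul_chebMean (k : ℕ) :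
    ∑ p ∈ antidiagonal (k + 1), weightedZ r y p.1 * chebMean r p.2
      = chebZ y k + r * chebZ y (k + 1) := by
  induction k with
  | zero => simp [Finset.Nat.antidiagonal_succ, weightedZ, chebMean, chebZ]
  | succ k ih =>
    have h1 : ∀ p ∈ antidiagonal k, weightedZ r y p.1 * chebMean r (p.2 + 1 + 1)
        = -r * (weightedZ r y p.1 * chebMean r (p.2 + 1)) := fun p _ => by
      simp only [chebMean, pow_succ]
      ring
    rw [Finset.Nat.sum_antidiagonal_succ'] at ih ⊢
    rw [Finset.Nat.sum_antidiagonal_succ', Finset.sum_congr rfl h1, ← Finset.mul_sum]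
    simp only [chebMean, mul_zero, zero_add] at ih ⊢
    rw [ih]
    simp only [weightedZ]
    ring

end Sequences

section TraceRelations

open Matrix

variable {A : Type*} [CommRing A] {n : ℕ} (B : Matrix (Fin n) (Fin n) A) (r : A)

/-- Differences of centred Chebyshev traces, i.e. centred traces of Chebyshev polynomials of the
first kind. -/
def chebTrace : ℕ → A
  | 0 => 0
  | k + 1 => trace (chebU B (k + 2)) - trace (chebU B k) - n * (chebMean r (k + 2) - chebMean r k)

lemma trace_chebU (k : ℕ) :
    trace (chebU B k) = chebZ (chebTrace B r) k + n * chebMean r k := by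
  induction k using Nat.twoStepInduction with
  | zero => simp [chebZ, chebMean]
  | one => simp [chebZ, chebMean]
  | more k h1 h2 =>
    simp only [chebZ, chebTrace, h1]
    ring

/-- The weight `1 + r² + r B`. -/
def weight : Matrix (Fin n) (Fin n) A := (1 + r ^ 2) • 1 + r • B

lemma trace_weight_mul_chebU (k : ℕ) :
    trace (weight B r * chebU B k)
      = weightedZ r (chebTrace B r) k + n * (if k = 1 then 1 else 0) := by
  cases k with
  | zero => simp [weightedZ]
  | succ k =>
    rw [weight, add_mul, smul_mul_assoc, smul_mul_assoc, mul_chebU_succ, one_mul]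
    simp only [trace_add, trace_smul, smul_eq_mul, trace_chebU B r, weightedZ]
    cases k with
    | zero => simp [chebMean]; ring
    | succ k => simp [chebMean]; ring

lemma trace_weight_mul_chebU_mul_chebU (k l : ℕ) :
    trace (weight B r * (chebU B k * chebU B l))
      = weightedZ₂ r (chebTrace B r) k l + n * (if k = l ∧ k ≠ 0 then 1 else 0) := by
  induction k using Nat.twoStepInduction generalizing l with
  | zero => simp [weightedZ₂]
  | one => simp [weightedZ₂, trace_weight_mul_chebU, eq_comm]
  | more k h1 h2 =>
    cases l with
    | zero => simp [weightedZ₂]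
    | succ l =>
      have e : chebU B (k + 2) * chebU B (l + 1) = chebU B (k + 1) * chebU B (l + 2)
          + chebU B (k + 1) * chebU B l - chebU B k * chebU B (l + 1) := by
        rw [← mul_add, ← mul_chebU_succ, ← mul_assoc,
            (commute_chebU B (Commute.refl B) (k + 1)).symm.eq,
          chebU_add_two, sub_mul, mul_assoc]
      rw [e, mul_sub, mul_add, trace_sub, trace_add, h1, h2, h2]
      simp only [weightedZ₂]
      have e2 : (if k + 2 = l + 1 ∧ k + 2 ≠ 0 then (1 : A) else 0)
          = (if k + 1 = l + 2 ∧ k + 1 ≠ 0 then 1 else 0) + (if k + 1 = l ∧ k + 1 ≠ 0 then 1 else 0)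
            - (if k = l + 1 ∧ k ≠ 0 then 1 else 0) := by
        split_ifs <;> first | omega | simp
      rw [e2]
      ring

lemma trace_schwinger_dyson {h : A} (hn : n * h = 1) (k : ℕ) :
    trace ((B + r • 1) * chebU B (k + 1))
        - h * ∑ p ∈ antidiagonal (k + 1), trace (weight B r * chebU B p.1) * trace (chebU B p.2)
      = chebTrace B r (k + 1) - h * ∑ p ∈ antidiagonal (k + 1),
        weightedZ r (chebTrace B r) p.1 * chebZ (chebTrace B r) p.2 := by
  have h1 : ∑ p ∈ antidiagonal (k + 1), (if p.1 = 1 then (1 : A) else 0) * trace (chebU B p.2)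
      = trace (chebU B k) := by
    rw [Finset.Nat.sum_antidiagonal_succ]
    cases k with
    | zero => simp
    | succ k => simp [Finset.Nat.sum_antidiagonal_succ]
  have h2 : ∑ p ∈ antidiagonal (k + 1), trace (weight B r * chebU B p.1) * trace (chebU B p.2)
      = (∑ p ∈ antidiagonal (k + 1), weightedZ r (chebTrace B r) p.1 * chebZ (chebTrace B r) p.2)
        + n * (∑ p ∈ antidiagonal (k + 1), weightedZ r (chebTrace B r) p.1 * chebMean r p.2)
        + n * ∑ p ∈ antidiagonal (k + 1), (if p.1 = 1 then (1 : A) else 0)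
            * trace (chebU B p.2) := by
    simp only [Finset.mul_sum, ← Finset.sum_add_distrib]
    refine Finset.sum_congr rfl fun p _ => ?_
    rw [trace_weight_mul_chebU, trace_chebU B r]
    ring
  rw [h2, h1, sum_weightedZ_mul_chebMean, add_mul, mul_chebU_succ, smul_mul_assoc, one_mul]
  simp only [trace_add, trace_smul, smul_eq_mul, trace_chebU B r, chebZ, chebMean]
  have e : ∀ x, h * (n * x) = x := fun x => by rw [← mul_assoc, mul_comm h, hn, one_mul]
  simp only [mul_add, e]
  ring

end TraceRelations

section SchwingerDyson

open Matrix MvPolynomial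

variable {n m : ℕ}

/-- The formal Wishart matrix, scaled and centred so that its spectrum is asymptotically
`[-2, 2]`. -/
abbrev formalW (n m : ℕ) (r : ℂ) : Matrix (Fin n) (Fin n) (MvPolynomial (CoordIdx n m) ℂ) :=
  formalB n m (r / n) (r + r⁻¹)

lemma smul_formalG_mul_formalGH {r : ℂ} (hr : r ≠ 0) :
    (r ^ 2 / n) • (formalG n m * formalGH n m) = weight (formalW n m r) (C r) := by
  have e : (1 : MvPolynomial (CoordIdx n m) ℂ) + C r ^ 2 = C (1 + r ^ 2) := by simp
  have e2 : ∀ (c : ℂ) (M : Matrix (Fin n) (Fin n) (MvPolynomial (CoordIdx n m) ℂ)),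
      (C c : MvPolynomial (CoordIdx n m) ℂ) • M = c • M := fun c M => by
    ext1; simp [C_mul']
  rw [weight, e, e2, e2, formalW, formalB, smul_sub, smul_smul, smul_smul]
  have e3 : r * (r + r⁻¹) = 1 + r ^ 2 := by field_simp; ring
  rw [e3, show r * (r / n) = r ^ 2 / n by ring]
  simp

lemma fieldDeriv_chebTrace (hn : n ≠ 0) {r : ℂ} (hr : r ≠ 0) (k l : ℕ) :
    C (r / n) * fieldDeriv n m (r / n) (r + r⁻¹) (k + 1) (chebTrace (formalW n m r) (C r) l)
      = carre (C r) (C (1 / n : ℂ)) (chebTrace (formalW n m r) (C r)) (k + 1) l := by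
  have hn' : (n : ℂ) ≠ 0 := by exact_mod_cast hn
  cases l with
  | zero => simp [chebTrace, carre]
  | succ l =>
    have h1 : fieldDeriv n m (r / n) (r + r⁻¹) (k + 1) (chebTrace (formalW n m r) (C r) (l + 1))
        = ((l : MvPolynomial (CoordIdx n m) ℂ) + 1) * (r / n) • trace (formalG n m * formalGH n m *
          (chebU (formalW n m r) (k + 1) * chebU (formalW n m r) (l + 1))) := by
      rw [chebTrace, map_sub, fieldDeriv_trace]
      have : (n : MvPolynomial (CoordIdx n m) ℂ) * (chebMean (C r) (l + 2) - chebMean (C r) l)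
          = C (n * (chebMean r (l + 2) - chebMean r l)) := by
        cases l <;> simp [chebMean]
      rw [this, derivation_C, sub_zero]
    have h2 : C (r / n) * (((l : MvPolynomial (CoordIdx n m) ℂ) + 1) * (r / n) •
        trace (formalG n m * formalGH n m *
          (chebU (formalW n m r) (k + 1) * chebU (formalW n m r) (l + 1))))
        = ((l : MvPolynomial (CoordIdx n m) ℂ) + 1) *
            (C (1 / n : ℂ) * trace (weight (formalW n m r) (C r) *
          (chebU (formalW n m r) (k + 1) * chebU (formalW n m r) (l + 1)))) := by
      rw [← smul_formalG_mul_formalGH hr, smul_mul_assoc, trace_smul, C_mul', C_mul', mul_smul_comm,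
        smul_smul, mul_smul_comm, mul_smul_comm, smul_smul]
      congr 1
      field_simp
    rw [h1, h2, trace_weight_mul_chebU_mul_chebU, carre, mul_add,
        ← mul_assoc _ (n : MvPolynomial _ ℂ)]
    have h3 : (C (1 / n : ℂ) : MvPolynomial (CoordIdx n m) ℂ) * n = 1 := by
      rw [← map_natCast C n, ← map_mul, one_div_mul_cancel hn', map_one]
    rw [h3]
    simp [add_comm]

theorem expect_chebTrace_mul_prod (hn : n ≠ 0) {r : ℂ} (hr : r ≠ 0) (hm : m * r ^ 2 = n)
    (k : ℕ) (L : List ℕ) :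
    expect n m (chebTrace (formalW n m r) (C r) k * (L.map (chebTrace (formalW n m r) (C r))).prod)
      = expect n m (C (1 / n : ℂ) * (∑ p ∈ antidiagonal k,
            weightedZ (C r) (chebTrace (formalW n m r) (C r)) p.1 *
              chebZ (chebTrace (formalW n m r) (C r)) p.2) *
            (L.map (chebTrace (formalW n m r) (C r))).prod
          + listDeriv (chebTrace (formalW n m r) (C r))
            (carre (C r) (C (1 / n : ℂ)) (chebTrace (formalW n m r) (C r)) k) L) := by
  have hn' : (n : ℂ) ≠ 0 := by exact_mod_cast hn
  have h3 : (n : MvPolynomial (CoordIdx n m) ℂ) * C (1 / n : ℂ) = 1 := by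
    rw [← map_natCast C n, ← map_mul, mul_one_div_cancel hn', map_one]
  cases k with
  | zero =>
    have : ∀ L, listDeriv (chebTrace (formalW n m r) (C r))
        (carre (C r) (C (1 / n : ℂ)) (chebTrace (formalW n m r) (C r)) 0) L = 0 := fun L => by
      induction L with
      | nil => rfl
      | cons l L ih =>
        rw [listDeriv, ih, carre]
        cases l <;> simp [weightedZ₂]
    rw [this]
    simp [chebTrace, weightedZ]
  | succ k =>
    set B := formalW n m r with hB
    set F := (L.map (chebTrace B (C r))).prod with hF
    have h1 := schwinger_dyson (n := n) (m := m) (r / n) (r + r⁻¹) (k + 1) F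
    rw [show formalB n m (r / n) (r + r⁻¹) = B from rfl] at h1
    have h2 : ∀ M, C (r / n) * trace (formalG n m * formalGH n m * M)
        = trace ((B + (C r : MvPolynomial (CoordIdx n m) ℂ) • 1) * M) + C r⁻¹ * trace M := by
      intro M
      have e2 : ∀ (c : ℂ) (M : Matrix (Fin n) (Fin n) (MvPolynomial (CoordIdx n m) ℂ)),
          (C c : MvPolynomial (CoordIdx n m) ℂ) • M = c • M := fun c M => by
        ext1; simp [C_mul']
      rw [C_mul', C_mul', ← trace_smul, ← trace_smul, ← trace_add, e2, hB, formalW, formalB,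
        ← smul_mul_assoc]
      congr 1
      rw [add_smul]
      simp only [add_mul, sub_mul, smul_mul_assoc, one_mul]
      abel
    have h4 : ∀ M, C (r / n) * ((r / n) • trace (formalG n m * formalGH n m * M))
        = C (1 / n : ℂ) * trace (weight B (C r) * M) := by
      intro M
      rw [← smul_formalG_mul_formalGH hr, smul_mul_assoc, trace_smul, C_mul', C_mul',
        smul_smul, smul_smul]
      congr 1
      field_simp
    have h5 : C (r / n) * fieldDeriv n m (r / n) (r + r⁻¹) (k + 1) F
        = listDeriv (chebTrace B (C r)) (carre (C r) (C (1 / n : ℂ))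
            (chebTrace B (C r)) (k + 1)) L := by
      rw [hF, derivation_list_prod, mul_listDeriv]
      congr 1
      ext1 l
      exact fieldDeriv_chebTrace hn hr k l
    have h6 : (C (r / n) : MvPolynomial (CoordIdx n m) ℂ) * (m : MvPolynomial (CoordIdx n m) ℂ)
        = C r⁻¹ := by
      rw [← map_natCast C m, ← map_mul, ← hm]
      congr 1
      have : (m : ℂ) ≠ 0 := fun h => hn' (by rw [← hm, h, zero_mul])
      field_simp
    have h7 := congrArg (fun x => (r / n) * x) h1
    simp only [← smul_eq_mul, ← map_smul] at h7
    simp only [smul_eq_mul, ← C_mul'] at h7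
    rw [← h5]
    have h8 := trace_schwinger_dyson B (C r) h3 k
    have e1 : C (r / n) * (trace (formalG n m * formalGH n m * chebU B (k + 1)) * F)
        = trace ((B + (C r : MvPolynomial (CoordIdx n m) ℂ) • 1) * chebU B (k + 1)) * F
          + C r⁻¹ * trace (chebU B (k + 1)) * F := by
      rw [← mul_assoc, h2, add_mul]
    have e2 : C (r / n) * ((m : MvPolynomial (CoordIdx n m) ℂ) * trace (chebU B (k + 1)) * F
        + C (r / n) * (∑ p ∈ antidiagonal (k + 1),
          trace (formalG n m * formalGH n m * chebU B p.1) * trace (chebU B p.2)) * F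
          + fieldDeriv n m (r / n) (r + r⁻¹) (k + 1) F)
        = C r⁻¹ * trace (chebU B (k + 1)) * F
          + (C (1 / n : ℂ) * ∑ p ∈ antidiagonal (k + 1),
            trace (weight B (C r) * chebU B p.1) * trace (chebU B p.2)) * F
          + C (r / n) * fieldDeriv n m (r / n) (r + r⁻¹) (k + 1) F := by
      rw [← h6, Finset.mul_sum _ _ (C (1 / n : ℂ) : MvPolynomial (CoordIdx n m) ℂ)]
      simp only [← mul_assoc, ← h4]
      simp only [C_mul', Finset.smul_sum, Finset.sum_mul, smul_mul_assoc, mul_add]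
    rw [e1, e2, map_add, map_add, map_add] at h7
    have e3 : chebTrace B (C r) (k + 1) * F
        = trace ((B + (C r : MvPolynomial (CoordIdx n m) ℂ) • 1) * chebU B (k + 1)) * F
          - (C (1 / n : ℂ) * ∑ p ∈ antidiagonal (k + 1),
            trace (weight B (C r) * chebU B p.1) * trace (chebU B p.2)) * F
          + (C (1 / n : ℂ) * ∑ p ∈ antidiagonal (k + 1),
        weightedZ (C r) (chebTrace B (C r)) p.1 * chebZ (chebTrace B (C r)) p.2) * F := by
      rw [← sub_mul, h8]
      ring
    rw [e3, map_add, map_sub, map_add]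
    linear_combination h7

end SchwingerDyson

section RealTraces

open Matrix MvPolynomial

variable {n m : ℕ}

lemma map_trace_chebU {A A' : Type*} [CommRing A] [CommRing A'] (f : A →+* A')
    (B : Matrix (Fin n) (Fin n) A) (k : ℕ) :
    f (trace (chebU B k)) = trace (chebU (f.mapMatrix B) k) := by
  rw [← map_chebU]
  simp [trace]

lemma map_chebTrace {A A' : Type*} [CommRing A] [CommRing A'] (f : A →+* A')
    (B : Matrix (Fin n) (Fin n) A) (r : A) (k : ℕ) :
    f (chebTrace B r k) = chebTrace (f.mapMatrix B) (f r) k := by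
  have h : ∀ k, f (chebMean r k) = chebMean (f r) k := fun k => by cases k <;> simp [chebMean]
  cases k with
  | zero => simp [chebTrace]
  | succ k => simp [chebTrace, map_trace_chebU, h]

/-- The Wishart matrix scaled and centred so that its spectrum is asymptotically `[-2, 2]`. -/
def scaledW (r : ℝ) (M : Matrix (Fin n) (Fin n) ℂ) : Matrix (Fin n) (Fin n) ℂ :=
  ((r / n : ℝ) : ℂ) • M - ((r + r⁻¹ : ℝ) : ℂ) • 1

lemma isHermitian_scaledW (r : ℝ) {M : Matrix (Fin n) (Fin n) ℂ} (hM : M.IsHermitian) :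
    (scaledW r M).IsHermitian := by
  unfold scaledW IsHermitian
  simp only [conjTranspose_sub, conjTranspose_smul, conjTranspose_one, hM.eq, Complex.star_def,
    Complex.conj_ofReal]

lemma isHermitian_chebU {B : Matrix (Fin n) (Fin n) ℂ} (hB : B.IsHermitian) (k : ℕ) :
    (chebU B k).IsHermitian := by
  induction k using Nat.twoStepInduction with
  | zero => simp
  | one => simp
  | more k h1 h2 =>
    refine IsHermitian.sub ?_ h1
    rw [IsHermitian, conjTranspose_mul, h2.eq, hB.eq]
    exact (commute_chebU B (Commute.refl B) _).symm.eq

lemma ofReal_re_trace {B : Matrix (Fin n) (Fin n) ℂ} (hB : B.IsHermitian) :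
    ((trace B).re : ℂ) = trace B := by
  refine Complex.conj_eq_iff_re.mp ?_
  conv_rhs => rw [← hB.eq]
  rw [trace_conjTranspose]
  rfl

/-- The real-valued centred Chebyshev traces of the scaled Wishart matrix. -/
def realTrace (r : ℝ) (M : Matrix (Fin n) (Fin n) ℂ) (k : ℕ) : ℝ :=
  (chebTrace (scaledW r M) (r : ℂ) k).re

lemma ofReal_realTrace (r : ℝ) {M : Matrix (Fin n) (Fin n) ℂ} (hM : M.IsHermitian) (k : ℕ) :
    (realTrace r M k : ℂ) = chebTrace (scaledW r M) (r : ℂ) k := by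
  have hB := isHermitian_scaledW r hM
  have h1 : ∀ k, ((chebMean r k : ℝ) : ℂ) = chebMean (r : ℂ) k := fun k => by
    cases k <;> simp [chebMean]
  have h2 : chebTrace (scaledW r M) (r : ℂ) k = ((match k with
      | 0 => 0
      | k + 1 => (trace (chebU (scaledW r M) (k + 2))).re - (trace (chebU (scaledW r M) k)).re
        - n * (chebMean r (k + 2) - chebMean r k) : ℝ) : ℂ) := by
    cases k with
    | zero => simp [chebTrace]
    | succ k =>
      simp only [chebTrace, Complex.ofReal_sub, Complex.ofReal_mul, h1,
        ofReal_re_trace (isHermitian_chebU hB _), Complex.ofReal_natCast]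
  rw [realTrace, h2, Complex.ofReal_re]

lemma coordEval_formalG (G : Matrix (Fin n) (Fin m) ℂ) :
    (formalG n m).map (coordEval G) = G := by
  ext i j
  simp only [formalG, map_apply, of_apply, map_add, map_smul, coordEval, aeval_X,
      coord, smul_eq_mul]
  simp [mul_comm Complex.I, Complex.re_add_im]

lemma coordEval_formalGH (G : Matrix (Fin n) (Fin m) ℂ) :
    (formalGH n m).map (coordEval G) = Gᴴ := by
  ext i j
  simp only [formalGH, map_apply, of_apply, map_sub, map_smul, coordEval, aeval_X, coord,
    smul_eq_mul]
  apply Complex.ext <;> simp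

lemma coordEval_formalW (r : ℝ) (G : Matrix (Fin n) (Fin m) ℂ) :
    (coordEval G : MvPolynomial (CoordIdx n m) ℂ →+* ℂ).mapMatrix (formalW n m r)
      = scaledW r (G * Gᴴ) := by
  have h : (formalG n m * formalGH n m).map (coordEval G) = G * Gᴴ := by
    refine Eq.trans ?_ (congrArg₂ (· * ·) (coordEval_formalG G) (coordEval_formalGH G))
    exact Matrix.map_mul (f := (coordEval G : MvPolynomial (CoordIdx n m) ℂ →+* ℂ))
  rw [RingHom.mapMatrix_apply, RingHom.coe_coe, formalW, formalB, scaledW,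
    Matrix.map_sub _ (map_sub _), Matrix.map_smul _ _ (fun x => map_smul (coordEval G) _ x),
    Matrix.map_smul _ _ (fun x => map_smul (coordEval G) _ x), h]
  simp

lemma coordEval_chebTrace (r : ℝ) (G : Matrix (Fin n) (Fin m) ℂ) (k : ℕ) :
    coordEval G (chebTrace (formalW n m r) (C (r : ℂ)) k) = (realTrace r (G * Gᴴ) k : ℂ) := by
  rw [ofReal_realTrace r (isHermitian_mul_conjTranspose_self G), ← coordEval_formalW]
  have := map_chebTrace (coordEval G : MvPolynomial (CoordIdx n m) ℂ →+* ℂ) (formalW n m r)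
    (C (r : ℂ)) k
  rw [RingHom.coe_coe] at this
  rw [this]
  simp [coordEval]

lemma coordEval_prod_chebTrace (r : ℝ) (G : Matrix (Fin n) (Fin m) ℂ) (L : List ℕ) :
    coordEval G (L.map (chebTrace (formalW n m r) (C (r : ℂ)))).prod
      = ((L.map (realTrace r (G * Gᴴ))).prod : ℝ) := by
  refine Eq.trans ?_ (map_list_prod Complex.ofRealHom _).symm
  rw [map_list_prod, List.map_map, List.map_map]
  congr 2
  ext1 k
  exact coordEval_chebTrace r G k

lemma integrable_prod_realTrace (r : ℝ) (L : List ℕ) :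
    Integrable (fun G => (L.map (realTrace r (G * Gᴴ))).prod) (gaussMatrix n m) := by
  have h := (integrable_coordEval (n := n) (m := m)
    (L.map (chebTrace (formalW n m r) (C (r : ℂ)))).prod).re
  simpa only [coordEval_prod_chebTrace, RCLike.re_to_complex, Complex.ofReal_re] using h

/-- The Schwinger--Dyson equations for the centred Chebyshev traces of a Wishart matrix. -/
theorem integral_realTrace_mul_prod (hn : n ≠ 0) {r : ℝ} (hr : r ≠ 0) (hm : m * r ^ 2 = n)
    (k : ℕ) (L : List ℕ) :
    ∫ G, realTrace r (G * Gᴴ) k * (L.map (realTrace r (G * Gᴴ))).prod ∂gaussMatrix n m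
      = ∫ G, ((1 / n) * (∑ p ∈ antidiagonal k, weightedZ r (realTrace r (G * Gᴴ)) p.1 *
          chebZ (realTrace r (G * Gᴴ)) p.2) * (L.map (realTrace r (G * Gᴴ))).prod
        + listDeriv (realTrace r (G * Gᴴ)) (carre r (1 / n) (realTrace r (G * Gᴴ)) k) L)
          ∂gaussMatrix n m := by
  have h := expect_chebTrace_mul_prod (n := n) (m := m) hn (r := (r : ℂ))
    (by exact_mod_cast hr) (by exact_mod_cast hm) k L
  rw [expect_apply, expect_apply] at h
  rw [← Complex.ofReal_inj, ← integral_complex_ofReal, ← integral_complex_ofReal]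
  refine Eq.trans (integral_congr_ae (.of_forall fun G => ?_)) (h.trans
    (integral_congr_ae (.of_forall fun G => ?_)))
  · simp only [map_mul, coordEval_prod_chebTrace, coordEval_chebTrace, Complex.ofReal_mul]
  · have eC : ∀ c : ℂ, coordEval G (C c) = c := fun c => by simp [coordEval]
    have eY : (fun i => coordEval G (chebTrace (formalW n m r) (C (r : ℂ)) i))
        = fun i => Complex.ofRealHom (realTrace r (G * Gᴴ) i) :=
      funext fun i => by rw [coordEval_chebTrace, Complex.ofRealHom_eq_coe]
    have er : coordEval G (C (r : ℂ) : MvPolynomial (CoordIdx n m) ℂ) = Complex.ofRealHom r := eC r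
    have eh : coordEval G (C (1 / n : ℂ) : MvPolynomial (CoordIdx n m) ℂ)
        = Complex.ofRealHom (1 / n) := (eC _).trans (by simp)
    have ez := fun k => map_chebZ (chebTrace (formalW n m r) (C (r : ℂ)))
      (coordEval G : MvPolynomial (CoordIdx n m) ℂ →+* ℂ) k
    have ew := fun k => map_weightedZ (C (r : ℂ)) (chebTrace (formalW n m r) (C (r : ℂ)))
      (coordEval G : MvPolynomial (CoordIdx n m) ℂ →+* ℂ) k
    have ed := map_listDeriv (chebTrace (formalW n m r) (C (r : ℂ)))
      (coordEval G : MvPolynomial (CoordIdx n m) ℂ →+* ℂ)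
      (carre (C (r : ℂ)) (C (1 / n : ℂ)) (chebTrace (formalW n m r) (C (r : ℂ))) k) L
    have ec := fun l => map_carre (C (r : ℂ)) (C (1 / n : ℂ))
        (chebTrace (formalW n m r) (C (r : ℂ)))
      (coordEval G : MvPolynomial (CoordIdx n m) ℂ →+* ℂ) k l
    simp only [RingHom.coe_coe, eY, er, eh] at ez ew ed ec
    simp only [ec] at ed
    simp only [map_add, map_mul, map_sum, coordEval_prod_chebTrace, ez, ew, ed, eh]
    simp only [← map_chebZ, ← map_weightedZ, ← map_carre, ← map_listDeriv]
    simp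

end RealTraces

section Families

variable {Θ : Type*} {Ω : Θ → Type*}

/-- A function of the parameter, as a family of constant functions. -/
def ofParam (c : Θ → ℝ) : (Σ θ, Ω θ) → ℝ := fun p => c p.1

@[simp] lemma ofParam_apply (c : Θ → ℝ) (p : Σ θ, Ω θ) : ofParam c p = c p.1 := rfl

variable (Y : ℕ → (Σ θ, Ω θ) → ℝ)

/-- Families of polynomials in the `Y k` of weighted degree at most `w`, with coefficients depending
on the parameter in a bounded way. -/
def polyFam (w : ℕ) : Submodule ℝ ((Σ θ, Ω θ) → ℝ) :=
  Submodule.span ℝ {f | ∃ (c : Θ → ℝ) (L : List ℕ), (∃ K, ∀ θ, |c θ| ≤ K) ∧ L.sum ≤ w ∧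
    f = ofParam c * (L.map Y).prod}

variable {Y}

lemma polyFam_mono {v w : ℕ} (h : v ≤ w) : polyFam Y v ≤ polyFam Y w :=
  Submodule.span_mono fun _ ⟨c, L, hc, hL, e⟩ => ⟨c, L, hc, hL.trans h, e⟩

lemma mul_mem_polyFam {v w : ℕ} {f g : (Σ θ, Ω θ) → ℝ} (hf : f ∈ polyFam Y v)
    (hg : g ∈ polyFam Y w) : f * g ∈ polyFam Y (v + w) := by
  have h := Submodule.mul_mem_mul hf hg
  rw [polyFam, polyFam, Submodule.span_mul_span] at h
  refine Submodule.span_mono ?_ h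
  rintro _ ⟨_, ⟨c, L, ⟨K, hK⟩, hL, rfl⟩, _, ⟨c', L', ⟨K', hK'⟩, hL', rfl⟩, rfl⟩
  refine ⟨fun θ => c θ * c' θ, L ++ L', ⟨K * K', fun θ => ?_⟩, ?_, ?_⟩
  · rw [abs_mul]
    exact mul_le_mul (hK θ) (hK' θ) (abs_nonneg _) ((abs_nonneg _).trans (hK θ))
  · rw [List.sum_append]
    exact add_le_add hL hL'
  · ext p
    simp only [Pi.mul_apply, List.map_append, List.prod_append, ofParam_apply]
    ring

lemma coeff_mem_polyFam {c : Θ → ℝ} (hc : ∃ K, ∀ θ, |c θ| ≤ K) (w : ℕ) :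
    ofParam c ∈ polyFam Y w :=
  Submodule.subset_span ⟨c, [], hc, Nat.zero_le _, by simp⟩

lemma const_mem_polyFam (c : ℝ) (w : ℕ) : (fun _ => c) ∈ polyFam Y w :=
  coeff_mem_polyFam (c := fun _ => c) ⟨|c|, fun _ => le_rfl⟩ w

lemma prod_mem_polyFam (L : List ℕ) : (L.map Y).prod ∈ polyFam Y L.sum :=
  Submodule.subset_span ⟨1, L, ⟨1, by simp⟩, le_rfl, by ext; simp⟩

lemma mem_polyFam (k : ℕ) : Y k ∈ polyFam Y k := by
  simpa using prod_mem_polyFam (Y := Y) [k]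

lemma chebZ_mem_polyFam (k : ℕ) : chebZ Y k ∈ polyFam Y (k - 1) := by
  induction k using Nat.twoStepInduction with
  | zero => exact zero_mem _
  | one => exact zero_mem _
  | more k h1 h2 =>
    exact add_mem (mem_polyFam (k + 1)) (polyFam_mono (by omega) h1)

variable (Y) in
/-- The algebra of families of polynomials in the `Y k`. -/
def polyAlg : Subalgebra ℝ ((Σ θ, Ω θ) → ℝ) where
  carrier := {f | ∃ w, f ∈ polyFam Y w}
  mul_mem' := fun ⟨_, hf⟩ ⟨_, hg⟩ => ⟨_, mul_mem_polyFam hf hg⟩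
  add_mem' := fun ⟨v, hf⟩ ⟨w, hg⟩ => ⟨v + w, add_mem (polyFam_mono (by omega) hf)
    (polyFam_mono (by omega) hg)⟩
  algebraMap_mem' := fun c => ⟨0, const_mem_polyFam c 0⟩

lemma self_mem_polyAlg (k : ℕ) : Y k ∈ polyAlg Y := ⟨k, mem_polyFam k⟩

lemma coeff_mem_polyAlg {c : Θ → ℝ} (hc : ∃ K, ∀ θ, |c θ| ≤ K) : ofParam c ∈ polyAlg Y :=
  ⟨0, coeff_mem_polyFam hc 0⟩

lemma chebZ_mem_polyAlg (k : ℕ) : chebZ Y k ∈ polyAlg Y := ⟨_, chebZ_mem_polyFam k⟩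

variable {r h : Θ → ℝ} (hr : ∃ K, ∀ θ, |r θ| ≤ K) (hh : ∃ K, ∀ θ, |h θ| ≤ K)

include hr in
lemma weightedZ_mem_polyFam (k : ℕ) : weightedZ (ofParam r) Y k ∈ polyFam Y k := by
  cases k with
  | zero => exact zero_mem _
  | succ k =>
    have h1 := coeff_mem_polyFam (Y := Y) hr 0
    have h2 : 1 + ofParam r ^ 2 ∈ polyFam Y 0 := by
      refine coeff_mem_polyFam (c := fun θ => 1 + r θ ^ 2) ?_ 0
      obtain ⟨K, hK⟩ := hr
      refine ⟨1 + K ^ 2, fun θ => ?_⟩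
      rw [abs_of_nonneg (by positivity), ← sq_abs]
      gcongr
      exact hK θ
    have h3 := mul_mem_polyFam h2 (chebZ_mem_polyFam (Y := Y) (k + 1))
    have h4 := mul_mem_polyFam h1 (add_mem (chebZ_mem_polyFam (Y := Y) (k + 2))
      (polyFam_mono (show k - 1 ≤ k + 2 - 1 by omega) (chebZ_mem_polyFam (Y := Y) k)))
    rw [weightedZ]
    exact add_mem (polyFam_mono (by omega) h3) (polyFam_mono (by omega) h4)

include hr in
lemma weightedZ₂_mem_polyFam (k l : ℕ) :
    weightedZ₂ (ofParam r) Y k l ∈ polyFam Y (k + l - 1) := by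
  induction k using Nat.twoStepInduction generalizing l with
  | zero => exact zero_mem _
  | one => exact polyFam_mono (by omega) (weightedZ_mem_polyFam hr l)
  | more k h1 h2 =>
    cases l with
    | zero => exact zero_mem _
    | succ l =>
      exact sub_mem (add_mem (polyFam_mono (by omega) (h2 (l + 2)))
        (polyFam_mono (by omega) (h2 l))) (polyFam_mono (by omega) (h1 (l + 1)))

lemma listDeriv_mem_polyFam {D : ℕ → (Σ θ, Ω θ) → ℝ} {k : ℕ} (hD : ∀ l, D l ∈ polyFam Y (k + l))
    (L : List ℕ) : listDeriv Y D L ∈ polyFam Y (k + L.sum) := by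
  induction L with
  | nil => exact zero_mem _
  | cons l L ih =>
    rw [List.sum_cons]
    exact add_mem (polyFam_mono (by omega) (mul_mem_polyFam (hD l) (prod_mem_polyFam L)))
      (polyFam_mono (by omega) (mul_mem_polyFam (mem_polyFam l) ih))

include hr in
lemma natCast_mul_weightedZ₂_mem_polyFam (k l : ℕ) :
    (fun _ => (l : ℝ)) * weightedZ₂ (ofParam r) Y (k + 1) l ∈ polyFam Y (k + l) :=
  polyFam_mono (by omega) (mul_mem_polyFam (const_mem_polyFam (l : ℝ) 0)
    (weightedZ₂_mem_polyFam hr (k + 1) l))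

include hr hh in
lemma carre_mem_polyFam (k l : ℕ) :
    carre (ofParam r) (ofParam h) Y (k + 1) l ∈ polyFam Y (k + l) := by
  have h1 := mul_mem_polyFam (coeff_mem_polyFam hh 0)
      (natCast_mul_weightedZ₂_mem_polyFam (Y := Y) hr k l)
  have h2 : (fun _ => l * (if k + 1 = l then 1 else 0) : (Σ θ, Ω θ) → ℝ) ∈ polyFam Y (k + l) :=
    const_mem_polyFam _ _
  convert add_mem h2 (polyFam_mono (by omega) h1) using 1
  ext p
  simp only [carre, Pi.add_apply, Pi.mul_apply, Pi.natCast_apply]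
  split_ifs <;> simp <;> ring

include hr in
lemma sum_weightedZ_mul_chebZ_mem_polyFam (k : ℕ) :
    ∑ p ∈ antidiagonal (k + 1), weightedZ (ofParam r) Y p.1 * chebZ Y p.2 ∈ polyFam Y k := by
  refine Submodule.sum_mem _ fun p hp => ?_
  rw [Finset.HasAntidiagonal.mem_antidiagonal] at hp
  rcases Nat.eq_zero_or_pos p.2 with h0 | h0
  · rw [h0, chebZ, mul_zero]
    exact zero_mem _
  · exact polyFam_mono (by omega)
      (mul_mem_polyFam (weightedZ_mem_polyFam hr p.1) (chebZ_mem_polyFam p.2))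

variable [∀ θ, MeasurableSpace (Ω θ)] (μ : ∀ θ, Measure (Ω θ)) [∀ θ, IsProbabilityMeasure (μ θ)]

/-- Families of integrable functions whose integrals are bounded uniformly in the parameter. -/
def boundedMean : Submodule ℝ ((Σ θ, Ω θ) → ℝ) where
  carrier := {f | (∀ θ, Integrable (fun ω => f ⟨θ, ω⟩) (μ θ)) ∧ ∃ K, ∀ θ, |∫ ω, f ⟨θ, ω⟩ ∂μ θ| ≤ K}
  zero_mem' := ⟨fun θ => by simp, 0, by simp⟩
  add_mem' := by
    rintro f g ⟨hf, K, hK⟩ ⟨hg, K', hK'⟩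
    refine ⟨fun θ => (hf θ).add (hg θ), K + K', fun θ => ?_⟩
    simp only [Pi.add_apply]
    rw [integral_add (hf θ) (hg θ)]
    exact (abs_add_le _ _).trans (add_le_add (hK θ) (hK' θ))
  smul_mem' := by
    rintro c f ⟨hf, K, hK⟩
    refine ⟨fun θ => (hf θ).smul c, |c| * K, fun θ => ?_⟩
    simp only [Pi.smul_apply, smul_eq_mul]
    rw [integral_const_mul, abs_mul]
    exact mul_le_mul_of_nonneg_left (hK θ) (abs_nonneg c)

variable {μ}

lemma coeff_mul_mem_boundedMean {c : Θ → ℝ} (hc : ∃ K, ∀ θ, |c θ| ≤ K) {f : (Σ θ, Ω θ) → ℝ}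
    (hf : f ∈ boundedMean μ) : ofParam c * f ∈ boundedMean μ := by
  obtain ⟨hf, K, hK⟩ := hf
  obtain ⟨K', hK'⟩ := hc
  refine ⟨fun θ => (hf θ).const_mul (c θ), K' * K, fun θ => ?_⟩
  simp only [Pi.mul_apply, ofParam_apply]
  rw [integral_const_mul, abs_mul]
  exact mul_le_mul (hK' θ) (hK θ) (abs_nonneg _) ((abs_nonneg _).trans (hK' θ))

/-- The family `Y` satisfies the Schwinger--Dyson equations. -/
structure SchwingerDysonFamily (μ : ∀ θ, Measure (Ω θ)) (Y : ℕ → (Σ θ, Ω θ) → ℝ) (r h : Θ → ℝ) :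
    Prop where
  bounded_left : ∃ K, ∀ θ, |r θ| ≤ K
  bounded_right : ∃ K, ∀ θ, |h θ| ≤ K
  zero : Y 0 = 0
  integrable : ∀ θ (L : List ℕ), Integrable (fun ω => (L.map Y).prod ⟨θ, ω⟩) (μ θ)
  integral_eq : ∀ θ k (L : List ℕ), ∫ ω, (Y k * (L.map Y).prod) ⟨θ, ω⟩ ∂μ θ
    = ∫ ω, (ofParam h * (∑ p ∈ antidiagonal k, weightedZ (ofParam r) Y p.1 * chebZ Y p.2)
        * (L.map Y).prod + listDeriv Y (carre (ofParam r) (ofParam h) Y k) L : (Σ θ, Ω θ) → ℝ)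
            ⟨θ, ω⟩ ∂μ θ

namespace SchwingerDysonFamily

theorem polyFam_le_boundedMean (H : SchwingerDysonFamily μ Y r h) (w : ℕ) :
    polyFam Y w ≤ boundedMean μ := by
  induction w using Nat.strong_induction_on with
  | _ w ih =>
    refine Submodule.span_le.mpr ?_
    rintro _ ⟨c, L, hc, hL, rfl⟩
    refine coeff_mul_mem_boundedMean hc ?_
    refine ⟨fun θ => H.integrable θ L, ?_⟩
    match L with
    | [] => exact ⟨1, fun θ => by simp⟩
    | 0 :: L => exact ⟨0, fun θ => by simp [H.zero]⟩
    | (k + 1) :: L =>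
      rw [List.sum_cons] at hL
      have h1 := mul_mem_polyFam (mul_mem_polyFam (coeff_mem_polyFam (Y := Y) H.bounded_right 0)
        (sum_weightedZ_mul_chebZ_mem_polyFam (Y := Y) H.bounded_left k)) (prod_mem_polyFam L)
      have h2 := listDeriv_mem_polyFam
          (carre_mem_polyFam (Y := Y) H.bounded_left H.bounded_right k) L
      obtain ⟨-, K, hK⟩ := ih (k + L.sum) (by omega)
        (add_mem (polyFam_mono (by omega) h1) h2)
      refine ⟨K, fun θ => ?_⟩
      rw [List.map_cons, List.prod_cons, H.integral_eq θ (k + 1) L]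
      exact hK θ

variable (H : SchwingerDysonFamily μ Y r h)
include H

lemma mem_boundedMean {f : (Σ θ, Ω θ) → ℝ} (hf : f ∈ polyAlg Y) : f ∈ boundedMean μ := by
  obtain ⟨w, hf⟩ := hf
  exact H.polyFam_le_boundedMean w hf

lemma integrable_of_mem {f : (Σ θ, Ω θ) → ℝ} (hf : f ∈ polyAlg Y) (θ : Θ) :
    Integrable (fun ω => f ⟨θ, ω⟩) (μ θ) := (H.mem_boundedMean hf).1 θ

lemma exists_integral_le {f : (Σ θ, Ω θ) → ℝ} (hf : f ∈ polyAlg Y) :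
    ∃ K, ∀ θ, |∫ ω, f ⟨θ, ω⟩ ∂μ θ| ≤ K := (H.mem_boundedMean hf).2

variable {l : Filter Θ} (hl : Tendsto h l (𝓝 0))
include hl

lemma tendsto_mul_integral {f : (Σ θ, Ω θ) → ℝ} (hf : f ∈ polyAlg Y) :
    Tendsto (fun θ => h θ * ∫ ω, f ⟨θ, ω⟩ ∂μ θ) l (𝓝 0) := by
  obtain ⟨K, hK⟩ := H.exists_integral_le hf
  exact hl.zero_mul_isBoundedUnder_le ⟨K, by simpa using Eventually.of_forall hK⟩

lemma tendsto_integral_sub (k : ℕ) (L : List ℕ) :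
    Tendsto (fun θ => ∫ ω, (Y k * (L.map Y).prod) ⟨θ, ω⟩ ∂μ θ
      - ∫ ω, listDeriv Y (fun l _ => l * if k = l then 1 else 0) L ⟨θ, ω⟩ ∂μ θ) l (𝓝 0) := by
  cases k with
  | zero =>
    have : ∀ L, listDeriv Y (fun l _ => l * if 0 = l then 1 else 0) L = 0 := fun L => by
      induction L with
      | nil => rfl
      | cons l L ih =>
        have : (fun _ => l * if 0 = l then 1 else 0 : (Σ θ, Ω θ) → ℝ) = 0 := by
          ext; cases l <;> simp
        rw [listDeriv, ih, this]
        simp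
    simp only [this]
    simp [H.zero, tendsto_const_nhds]
  | succ k =>
    set g : (Σ θ, Ω θ) → ℝ := (∑ p ∈ antidiagonal (k + 1),
      weightedZ (ofParam r) Y p.1 * chebZ Y p.2) * (L.map Y).prod
      + listDeriv Y (fun l => (fun _ => (l : ℝ)) * weightedZ₂ (ofParam r) Y (k + 1) l) L with hg
    have hgm : g ∈ polyAlg Y := add_mem (mul_mem
        ⟨_, sum_weightedZ_mul_chebZ_mem_polyFam H.bounded_left k⟩
      ⟨_, prod_mem_polyFam L⟩) ⟨_, listDeriv_mem_polyFam
        (natCast_mul_weightedZ₂_mem_polyFam H.bounded_left k) L⟩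
    have h1 : ∀ L, listDeriv Y (carre (ofParam r) (ofParam h) Y (k + 1)) L
        = listDeriv Y (fun l _ => l * if k + 1 = l then 1 else 0) L
          + (ofParam h) * listDeriv Y (fun l => (fun _ => (l : ℝ)) *
              weightedZ₂ (ofParam r) Y (k + 1) l) L := by
      intro L
      induction L with
      | nil => simp [listDeriv]
      | cons l L ih =>
        rw [listDeriv, ih, listDeriv, listDeriv]
        have : carre (ofParam r) (ofParam h) Y (k + 1) l
            = (fun _ => (l : ℝ) * if k + 1 = l then 1 else 0)
              + (ofParam h) * ((fun _ => (l : ℝ)) * weightedZ₂ (ofParam r) Y (k + 1) l) := by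
          ext p
          simp only [carre, Pi.add_apply, Pi.mul_apply, Pi.natCast_apply]
          split_ifs <;> simp <;> ring
        rw [this]
        ring
    have h2 : listDeriv Y (fun l _ => l * if k + 1 = l then 1 else 0) L ∈ polyAlg Y :=
      ⟨_, listDeriv_mem_polyFam (k := k) (fun l => const_mem_polyFam _ _) L⟩
    refine (H.tendsto_mul_integral hl hgm).congr fun θ => ?_
    rw [H.integral_eq, h1, ← integral_sub, ← integral_const_mul]
    · refine integral_congr_ae (.of_forall fun ω => ?_)
      simp only [hg, Pi.add_apply, Pi.mul_apply, ofParam_apply]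
      ring
    · refine H.integrable_of_mem (add_mem (mul_mem (mul_mem (coeff_mem_polyAlg H.bounded_right)
        ⟨_, sum_weightedZ_mul_chebZ_mem_polyFam H.bounded_left k⟩) ⟨_, prod_mem_polyFam L⟩)
        (add_mem h2 (mul_mem (coeff_mem_polyAlg H.bounded_right) ⟨_, listDeriv_mem_polyFam
          (natCast_mul_weightedZ₂_mem_polyFam H.bounded_left k) L⟩))) θ
    · exact H.integrable_of_mem h2 θ

end SchwingerDysonFamily

end Families

section Moments

variable {Θ : Type*} {Ω : Θ → Type*} [∀ θ, MeasurableSpace (Ω θ)]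

/-- The means of the family `f` converge to `x` along `l`. -/
structure MeanTendsto (μ : ∀ θ, Measure (Ω θ)) (l : Filter Θ) (f : (Σ θ, Ω θ) → ℝ) (x : ℝ) :
    Prop where
  integrable : ∀ θ, Integrable (fun ω => f ⟨θ, ω⟩) (μ θ)
  tendsto : Tendsto (fun θ => ∫ ω, f ⟨θ, ω⟩ ∂μ θ) l (𝓝 x)

namespace MeanTendsto

variable {μ : ∀ θ, Measure (Ω θ)} {l : Filter Θ} {f g : (Σ θ, Ω θ) → ℝ} {x y : ℝ}

lemma add (hf : MeanTendsto μ l f x) (hg : MeanTendsto μ l g y) :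
    MeanTendsto μ l (f + g) (x + y) where
  integrable θ := (hf.integrable θ).add (hg.integrable θ)
  tendsto := (hf.tendsto.add hg.tendsto).congr fun θ =>
    (integral_add (hf.integrable θ) (hg.integrable θ)).symm

lemma smul (c : ℝ) (hf : MeanTendsto μ l f x) : MeanTendsto μ l (c • f) (c * x) where
  integrable θ := (hf.integrable θ).smul c
  tendsto := (hf.tendsto.const_mul c).congr fun _ => (integral_const_mul c _).symm

lemma sum {ι : Type*} {s : Finset ι} {f : ι → (Σ θ, Ω θ) → ℝ} {x : ι → ℝ}
    (h : ∀ i ∈ s, MeanTendsto μ l (f i) (x i)) :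
    MeanTendsto μ l (∑ i ∈ s, f i) (∑ i ∈ s, x i) where
  integrable θ := by
    simp only [Finset.sum_apply]
    exact integrable_finsetSum s fun i hi => (h i hi).integrable θ
  tendsto := by
    refine (tendsto_finsetSum s fun i hi => (h i hi).tendsto).congr fun θ => ?_
    simp only [Finset.sum_apply]
    exact (integral_finsetSum s fun i hi => (h i hi).integrable θ).symm

lemma one [∀ θ, IsProbabilityMeasure (μ θ)] : MeanTendsto μ l 1 1 :=
  ⟨fun _ => integrable_const 1, by simp [tendsto_const_nhds]⟩

/-- The product of independent copies of `f` and `g`. -/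
def tensor (f g : (Σ θ, Ω θ) → ℝ) : (Σ θ, Ω θ × Ω θ) → ℝ :=
  fun p => f ⟨p.1, p.2.1⟩ * g ⟨p.1, p.2.2⟩

lemma tensor_tendsto [∀ θ, IsProbabilityMeasure (μ θ)]
    (hf : MeanTendsto μ l f x) (hg : MeanTendsto μ l g y) :
    MeanTendsto (fun θ => (μ θ).prod (μ θ)) l (tensor f g) (x * y) where
  integrable θ := (hf.integrable θ).mul_prod (hg.integrable θ)
  tendsto := (hf.tendsto.mul hg.tendsto).congr fun θ => (integral_prod_mul
    (fun ω => f ⟨θ, ω⟩) (fun ω => g ⟨θ, ω⟩)).symm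

end MeanTendsto

open MeanTendsto in
/-- The difference of two independent copies of `f`. -/
def copyDiff (f : (Σ θ, Ω θ) → ℝ) : (Σ θ, Ω θ × Ω θ) → ℝ :=
  fun p => f ⟨p.1, p.2.1⟩ - f ⟨p.1, p.2.2⟩

namespace SchwingerDysonFamily

variable {μ : ∀ θ, Measure (Ω θ)} [∀ θ, IsProbabilityMeasure (μ θ)] {Y : ℕ → (Σ θ, Ω θ) → ℝ}
  {r h : Θ → ℝ} (H : SchwingerDysonFamily μ Y r h) {l : Filter Θ} (hl : Tendsto h l (𝓝 0))
include H hl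

lemma meanTendsto_of_mul_prod {k : ℕ} {L : List ℕ} {f : (Σ θ, Ω θ) → ℝ} {x : ℝ}
    (hf : f = Y k * (L.map Y).prod)
    (hx : MeanTendsto μ l (listDeriv Y (fun l _ => l * if k = l then 1 else 0) L) x) :
    MeanTendsto μ l f x where
  integrable θ := by
    rw [hf]
    exact H.integrable θ (k :: L)
  tendsto := by
    rw [hf]
    simpa using (H.tendsto_integral_sub hl k L).add hx.tendsto

lemma meanTendsto (k : ℕ) : MeanTendsto μ l (Y k) 0 :=
  H.meanTendsto_of_mul_prod hl (k := k) (L := []) (by simp) ⟨fun θ => by simp [listDeriv],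
    by simp [listDeriv, tendsto_const_nhds]⟩

lemma meanTendsto_mul (k p : ℕ) :
    MeanTendsto μ l (Y k * Y p) (p * if k = p then 1 else 0) := by
  refine H.meanTendsto_of_mul_prod hl (k := k) (L := [p]) (by simp) ?_
  have := (MeanTendsto.one (μ := μ) (l := l)).smul (p * if k = p then 1 else 0)
  convert this using 1
  · ext; simp [listDeriv]
  · simp

lemma meanTendsto_mul_mul (k p q : ℕ) : MeanTendsto μ l (Y k * (Y p * Y q)) 0 := by
  refine H.meanTendsto_of_mul_prod hl (k := k) (L := [p, q]) (by simp) ?_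
  have := ((H.meanTendsto hl q).smul (p * if k = p then 1 else 0)).add
    ((H.meanTendsto hl p).smul (q * if k = q then 1 else 0))
  convert this using 1
  · ext
    simp only [listDeriv, List.map_cons, List.map_nil, List.prod_cons, List.prod_nil, Pi.add_apply,
      Pi.mul_apply, Pi.smul_apply, Pi.one_apply, Pi.zero_apply, smul_eq_mul]
    ring
  · simp

lemma meanTendsto_mul_mul_mul (k p q t : ℕ) : MeanTendsto μ l (Y k * (Y p * (Y q * Y t)))
    ((p * if k = p then 1 else 0) * (t * if q = t then 1 else 0)
      + (q * if k = q then 1 else 0) * (t * if p = t then 1 else 0)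
      + (t * if k = t then 1 else 0) * (q * if p = q then 1 else 0)) := by
  refine H.meanTendsto_of_mul_prod hl (k := k) (L := [p, q, t]) (by simp) ?_
  have := (((H.meanTendsto_mul hl q t).smul (p * if k = p then 1 else 0)).add
    ((H.meanTendsto_mul hl p t).smul (q * if k = q then 1 else 0))).add
    ((H.meanTendsto_mul hl p q).smul (t * if k = t then 1 else 0))
  convert this using 1
  ext
  simp only [listDeriv, List.map_cons, List.map_nil, List.prod_cons, List.prod_nil, Pi.add_apply,
    Pi.mul_apply, Pi.smul_apply, Pi.one_apply, Pi.zero_apply, smul_eq_mul]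
  ring

end SchwingerDysonFamily

/-- Linear combination of the `Y k`. -/
def linFam (Y : ℕ → (Σ θ, Ω θ) → ℝ) (s : Finset ℕ) (c : ℕ → ℝ) : (Σ θ, Ω θ) → ℝ :=
  ∑ k ∈ s, c k • Y k

/-- Limiting covariance of linear combinations of the `Y k`. -/
def covForm (s : Finset ℕ) (c d : ℕ → ℝ) : ℝ := ∑ k ∈ s, k * (c k * d k)

lemma sum_sum_covForm (s : Finset ℕ) (c d : ℕ → ℝ) :
    ∑ k ∈ s, ∑ p ∈ s, c k * d p * (p * if k = p then 1 else 0) = covForm s c d := by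
  refine Finset.sum_congr rfl fun k hk => ?_
  rw [Finset.sum_eq_single_of_mem k hk fun p _ hp => by simp [hp.symm]]
  simp; ring

namespace SchwingerDysonFamily

variable {μ : ∀ θ, Measure (Ω θ)} [∀ θ, IsProbabilityMeasure (μ θ)] {Y : ℕ → (Σ θ, Ω θ) → ℝ}
  {r h : Θ → ℝ} (H : SchwingerDysonFamily μ Y r h) {l : Filter Θ} (hl : Tendsto h l (𝓝 0))
  (s : Finset ℕ) (c d : ℕ → ℝ)
include H hl

lemma meanTendsto_linFam : MeanTendsto μ l (linFam Y s c) 0 := by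
  have := MeanTendsto.sum (s := s) fun k _ => (H.meanTendsto hl k).smul (c k)
  simpa [linFam] using this

lemma meanTendsto_linFam_mul :
    MeanTendsto μ l (linFam Y s c * linFam Y s d) (covForm s c d) := by
  have := MeanTendsto.sum (s := s) fun k _ => MeanTendsto.sum (s := s) fun p _ =>
    (H.meanTendsto_mul hl k p).smul (c k * d p)
  rw [sum_sum_covForm] at this
  convert this using 1
  rw [linFam, linFam, Finset.sum_mul_sum]
  simp only [smul_mul_smul_comm]

lemma meanTendsto_linFam_mul_mul (e : ℕ → ℝ) :
    MeanTendsto μ l (linFam Y s c * (linFam Y s d * linFam Y s e)) 0 := by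
  have := MeanTendsto.sum (s := s) fun k _ => MeanTendsto.sum (s := s) fun p _ =>
    MeanTendsto.sum (s := s) fun q _ =>
    (H.meanTendsto_mul_mul hl k p q).smul (c k * (d p * e q))
  simp only [mul_zero, Finset.sum_const_zero] at this
  convert this using 1
  simp only [linFam, Finset.sum_mul]
  simp only [Finset.mul_sum, smul_mul_smul_comm]

lemma meanTendsto_linFam_mul_mul_mul :
    MeanTendsto μ l (linFam Y s c * (linFam Y s c * (linFam Y s d * linFam Y s d)))
      (covForm s c c * covForm s d d + 2 * covForm s c d ^ 2) := by
  have := MeanTendsto.sum (s := s) fun k _ => MeanTendsto.sum (s := s) fun p _ =>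
    MeanTendsto.sum (s := s) fun q _ => MeanTendsto.sum (s := s) fun t _ =>
    (H.meanTendsto_mul_mul_mul hl k p q t).smul (c k * (c p * (d q * d t)))
  convert this using 1
  · simp only [linFam, Finset.sum_mul]
    simp only [Finset.mul_sum, smul_mul_smul_comm]
  · have e1 : covForm s c c * covForm s d d = ∑ k ∈ s, ∑ p ∈ s, ∑ q ∈ s, ∑ t ∈ s,
        (c k * (c p * (d q * d t))) *
          ((p * if k = p then 1 else 0) * (t * if q = t then 1 else 0)) := by
      rw [← sum_sum_covForm s c c, ← sum_sum_covForm s d d]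
      simp only [Finset.sum_mul]
      simp only [Finset.mul_sum]
      refine Finset.sum_congr rfl fun k _ => Finset.sum_congr rfl fun p _ =>
        Finset.sum_congr rfl fun q _ => Finset.sum_congr rfl fun t _ => by ring
    have e2 : covForm s c d ^ 2 = ∑ k ∈ s, ∑ p ∈ s, ∑ q ∈ s, ∑ t ∈ s,
        (c k * (c p * (d q * d t))) *
          ((q * if k = q then 1 else 0) * (t * if p = t then 1 else 0)) := by
      rw [← sum_sum_covForm s c d, pow_two]
      simp only [Finset.sum_mul]
      simp only [Finset.mul_sum]
      refine Finset.sum_congr rfl fun k _ => ?_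
      rw [Finset.sum_comm]
      refine Finset.sum_congr rfl fun p _ =>
        Finset.sum_congr rfl fun q _ => Finset.sum_congr rfl fun t _ => by ring
    have e3 : covForm s c d ^ 2 = ∑ k ∈ s, ∑ p ∈ s, ∑ q ∈ s, ∑ t ∈ s,
        (c k * (c p * (d q * d t))) *
          ((t * if k = t then 1 else 0) * (q * if p = q then 1 else 0)) := by
      rw [e2]
      refine Finset.sum_congr rfl fun k _ => Finset.sum_congr rfl fun p _ => ?_
      rw [Finset.sum_comm]
      refine Finset.sum_congr rfl fun q _ => Finset.sum_congr rfl fun t _ => by ring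
    simp only [mul_add, Finset.sum_add_distrib]
    rw [← e1, ← e2, ← e3]
    ring

open MeanTendsto

lemma meanTendsto_copyDiff_mul :
    MeanTendsto (fun θ => (μ θ).prod (μ θ)) l
      (copyDiff (linFam Y s c) * copyDiff (linFam Y s d)) (2 * covForm s c d) := by
  have ha := H.meanTendsto_linFam hl s c
  have hb := H.meanTendsto_linFam hl s d
  have hab := H.meanTendsto_linFam_mul hl s c d
  have h1 := MeanTendsto.one (μ := μ) (l := l)
  convert ((hab.tensor_tendsto h1).add (((ha.tensor_tendsto hb).add
    (hb.tensor_tendsto ha)).smul (-1))).add (h1.tensor_tendsto hab) using 1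
  · ext p
    simp only [copyDiff, tensor, Pi.add_apply, Pi.mul_apply, Pi.smul_apply, smul_eq_mul,
      Pi.one_apply]
    ring
  · ring

lemma meanTendsto_copyDiff_sq_mul_sq :
    MeanTendsto (fun θ => (μ θ).prod (μ θ)) l
      (copyDiff (linFam Y s c) ^ 2 * copyDiff (linFam Y s d) ^ 2)
      (4 * (covForm s c c * covForm s d d) + 8 * covForm s c d ^ 2) := by
  have ha := H.meanTendsto_linFam hl s c
  have hb := H.meanTendsto_linFam hl s d
  have haa := H.meanTendsto_linFam_mul hl s c c
  have hab := H.meanTendsto_linFam_mul hl s c d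
  have hbb := H.meanTendsto_linFam_mul hl s d d
  have haab := H.meanTendsto_linFam_mul_mul hl s c c d
  have habb := H.meanTendsto_linFam_mul_mul hl s c d d
  have haabb := H.meanTendsto_linFam_mul_mul_mul hl s c d
  have h1 := MeanTendsto.one (μ := μ) (l := l)
  convert ((((haabb.tensor_tendsto h1).add (h1.tensor_tendsto haabb)).add
    ((haa.tensor_tendsto hbb).add (hbb.tensor_tendsto haa))).add
    ((((haab.tensor_tendsto hb).add (hb.tensor_tendsto haab)).add
    ((habb.tensor_tendsto ha).add (ha.tensor_tendsto habb))).smul (-2))).add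
    ((hab.tensor_tendsto hab).smul 4) using 1
  · ext p
    simp only [copyDiff, tensor, Pi.add_apply, Pi.mul_apply, Pi.smul_apply, smul_eq_mul,
      Pi.one_apply, Pi.pow_apply]
    ring
  · ring

end SchwingerDysonFamily

end Moments

section EvenPowers

lemma choose_two_mul_succ (P κ : ℕ) : (2 * (P + 1)).choose (P + 1 + (κ + 1))
    = (2 * P).choose (P + κ) + 2 * (2 * P).choose (P + (κ + 1)) + (2 * P).choose (P + (κ + 2)) := by
  rw [show 2 * (P + 1) = 2 * P + 1 + 1 by ring, show P + 1 + (κ + 1) = P + κ + 1 + 1 by ring,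
    Nat.choose_succ_succ, Nat.choose_succ_succ, Nat.choose_succ_succ]
  simp only [← Nat.add_assoc]
  ring

lemma choose_two_mul_succ_self (P : ℕ) : (2 * (P + 1)).choose (P + 1)
    = 2 * (2 * P).choose P + 2 * (2 * P).choose (P + 1) := by
  cases P with
  | zero => rfl
  | succ P =>
    have h : (2 * (P + 1)).choose P = (2 * (P + 1)).choose (P + 2) :=
      Nat.choose_symm_of_eq_add (by ring)
    rw [show 2 * (P + 1 + 1) = 2 * (P + 1) + 1 + 1 by ring, Nat.choose_succ_succ,
      Nat.choose_succ_succ, Nat.choose_succ_succ, h]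
    simp only [Nat.succ_eq_add_one, Nat.add_assoc, Nat.reduceAdd]
    ring

lemma pow_two_mul_eq_sum_chebU {A : Type*} [CommRing A] (b : A) {P R : ℕ} (h : P ≤ R) :
    b ^ (2 * P) = (2 * P).choose P + ∑ κ ∈ Finset.range R,
      ((2 * P).choose (P + (κ + 1)) : A) * (chebU b (2 * κ + 3) - chebU b (2 * κ + 1)) := by
  induction P generalizing R with
  | zero => simp
  | succ P ih =>
    obtain ⟨R, rfl⟩ : ∃ R', R = R' + 1 := ⟨R - 1, by omega⟩
    set D : ℕ → A := fun κ => chebU b (2 * κ + 3) - chebU b (2 * κ + 1) with hD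
    set f : ℕ → A := fun κ => ((2 * P).choose (P + (κ + 1)) : A) with hf
    have h0 : b ^ 2 * D 0 = D 1 + 2 * D 0 + 2 := by
      simp [hD, chebU]
      ring
    have h1 : ∀ κ, b ^ 2 * D (κ + 1) = D (κ + 2) + 2 * D (κ + 1) + D κ := fun κ => by
      simp only [hD, show 2 * (κ + 2) = 2 * κ + 4 by ring, show 2 * (κ + 1) = 2 * κ + 2 by ring,
        Nat.add_assoc, Nat.reduceAdd]
      simp only [chebU_add_two]
      ring
    have hD0 : b ^ 2 = D 0 + 2 := by
      simp [hD, chebU]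
      ring
    have f1 : f R = 0 := by
      simp only [hf]
      rw [Nat.choose_eq_zero_of_lt (by omega), Nat.cast_zero]
    have f2 : f (R + 1) = 0 := by
      simp only [hf]
      rw [Nat.choose_eq_zero_of_lt (by omega), Nat.cast_zero]
    have e0 : ((2 * (P + 1)).choose (P + 1 + (0 + 1)) : A)
        = (2 * P).choose P + 2 * f 0 + f 1 := by
      rw [choose_two_mul_succ]
      simp [hf]
    have e1 : ∀ κ, ((2 * (P + 1)).choose (P + 1 + (κ + 1 + 1)) : A)
        = f κ + 2 * f (κ + 1) + f (κ + 2) := fun κ => by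
      rw [choose_two_mul_succ]
      simp only [hf]
      push_cast
      rfl
    have e2 : ((2 * (P + 1)).choose (P + 1) : A) = 2 * (2 * P).choose P + 2 * f 0 := by
      rw [choose_two_mul_succ_self]
      simp [hf]
    have s1 : ∑ κ ∈ Finset.range R, f (κ + 1) * D (κ + 2) + f 0 * D 1
        = ∑ κ ∈ Finset.range R, f κ * D (κ + 1) := by
      rw [← Finset.sum_range_succ' (fun κ => f κ * D (κ + 1)), Finset.sum_range_succ, f1]
      simp
    have s2 : ∑ κ ∈ Finset.range R, f (κ + 1) * D κ
        = ∑ κ ∈ Finset.range R, f (κ + 2) * D (κ + 1) + f 1 * D 0 := by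
      rw [← Finset.sum_range_succ' (fun κ => f (κ + 1) * D κ), Finset.sum_range_succ, f2]
      simp
    rw [show 2 * (P + 1) = 2 + 2 * P by ring, pow_add, ih (R := R + 1) (by omega),
      show 2 + 2 * P = 2 * (P + 1) by ring]
    rw [Finset.sum_range_succ', Finset.sum_range_succ', e0, e2]
    simp only [e1]
    change b ^ 2 * (_ + (∑ κ ∈ Finset.range R, f (κ + 1) * D (κ + 1) + f 0 * D 0))
      = _ + (∑ κ ∈ Finset.range R, (f κ + 2 * f (κ + 1) + f (κ + 2)) * D (κ + 1) + _ * D 0)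
    have s3 : b ^ 2 * ∑ κ ∈ Finset.range R, f (κ + 1) * D (κ + 1)
        = ∑ κ ∈ Finset.range R, f (κ + 1) * D (κ + 2)
          + 2 * ∑ κ ∈ Finset.range R, f (κ + 1) * D (κ + 1)
          + ∑ κ ∈ Finset.range R, f (κ + 1) * D κ := by
      rw [Finset.mul_sum, Finset.mul_sum, ← Finset.sum_add_distrib, ← Finset.sum_add_distrib]
      refine Finset.sum_congr rfl fun κ _ => ?_
      linear_combination f (κ + 1) * h1 κ
    have s4 : ∑ κ ∈ Finset.range R, (f κ + 2 * f (κ + 1) + f (κ + 2)) * D (κ + 1)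
        = ∑ κ ∈ Finset.range R, f κ * D (κ + 1)
          + 2 * ∑ κ ∈ Finset.range R, f (κ + 1) * D (κ + 1)
          + ∑ κ ∈ Finset.range R, f (κ + 2) * D (κ + 1) := by
      rw [Finset.mul_sum, ← Finset.sum_add_distrib, ← Finset.sum_add_distrib]
      refine Finset.sum_congr rfl fun κ _ => by ring
    linear_combination s3 - s4 + s1 + s2 + f 0 * h0 + ((2 * P).choose P : A) * hD0

variable {A : Type*} [CommRing A] {n : ℕ}

/-- Limiting means of normalised traces of even powers. -/
def evenMean (r : A) (P : ℕ) : A := (2 * P).choose P + ∑ κ ∈ Finset.range P,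
  ((2 * P).choose (P + (κ + 1)) : A) * (chebMean r (2 * κ + 3) - chebMean r (2 * κ + 1))

open Matrix in
lemma trace_pow_two_mul (B : Matrix (Fin n) (Fin n) A) (r : A) {P R : ℕ} (h : P ≤ R) :
    trace (B ^ (2 * P)) = n * evenMean r P + ∑ κ ∈ Finset.range R,
      ((2 * P).choose (P + (κ + 1)) : A) * chebTrace B r (2 * κ + 2) := by
  have key : B ^ (2 * P) = (2 * P).choose P • (1 : Matrix (Fin n) (Fin n) A)
      + ∑ κ ∈ Finset.range R, (2 * P).choose (P + (κ + 1)) •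
        (chebU B (2 * κ + 3) - chebU B (2 * κ + 1)) := by
    have := congrArg (Polynomial.aeval (R := ℤ) B) (pow_two_mul_eq_sum_chebU Polynomial.X h)
    have e : ∀ k, Polynomial.aeval (R := ℤ) B (chebU Polynomial.X k) = chebU B k := fun k => by
      have := map_chebU Polynomial.X
          (Polynomial.aeval (R := ℤ) B : Polynomial ℤ →+* Matrix (Fin n) (Fin n) A) k
      simpa using this
    simpa [e, nsmul_eq_mul] using this
  have hR : ∑ κ ∈ Finset.range P, ((2 * P).choose (P + (κ + 1)) : A) *
        (chebMean r (2 * κ + 3) - chebMean r (2 * κ + 1))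
      = ∑ κ ∈ Finset.range R, ((2 * P).choose (P + (κ + 1)) : A) *
        (chebMean r (2 * κ + 3) - chebMean r (2 * κ + 1)) := by
    refine Finset.sum_subset (Finset.range_subset_range.mpr h) fun κ _ hκ => ?_
    rw [Finset.mem_range, not_lt] at hκ
    rw [Nat.choose_eq_zero_of_lt (by omega), Nat.cast_zero, zero_mul]
  rw [key, evenMean, hR, trace_add, trace_smul, trace_one, trace_sum, Fintype.card_fin, mul_add,
    Finset.mul_sum, add_assoc, ← Finset.sum_add_distrib, nsmul_eq_mul]
  congr 1
  · ring
  · refine Finset.sum_congr rfl fun κ _ => ?_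
    rw [trace_smul, trace_sub, nsmul_eq_mul, chebTrace]
    ring

end EvenPowers

section TestCoefficients

lemma choose_two_mul_mul (P κ : ℕ) : ((2 * P).choose (P + (κ + 1)) : ℝ) * (P + (κ + 1))
    = (2 * P).choose (P + κ) * (P - κ) := by
  rcases le_or_gt κ P with h | h
  · have := Nat.choose_succ_right_eq (2 * P) (P + κ)
    rw [show 2 * P - (P + κ) = P - κ by omega] at this
    have := congrArg (Nat.cast (R := ℝ)) this
    push_cast [h] at this
    rw [← this, ← Nat.add_assoc]
    ring
  · rw [Nat.choose_eq_zero_of_lt (by omega), Nat.choose_eq_zero_of_lt (by omega)]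
    simp

lemma sum_choose_mul_choose {P Q R : ℕ} (h : P ≤ R) :
    ∑ κ ∈ Finset.range R, (2 * κ + 2 : ℝ) *
      ((2 * P).choose (P + (κ + 1)) * (2 * Q).choose (Q + (κ + 1))) * (P + Q)
      = P * Q * ((2 * P).choose P * (2 * Q).choose Q) := by
  set F : ℕ → ℝ := fun κ => (2 * P).choose (P + κ) * (P - κ) * ((2 * Q).choose (Q + κ) * (Q - κ))
    with hF
  have h1 : ∀ κ ∈ Finset.range R, (2 * κ + 2 : ℝ) *
      ((2 * P).choose (P + (κ + 1)) * (2 * Q).choose (Q + (κ + 1))) * (P + Q)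
      = F κ - F (κ + 1) := fun κ _ => by
    simp only [hF]
    rw [← choose_two_mul_mul, ← choose_two_mul_mul Q κ]
    push_cast
    ring
  rw [Finset.sum_congr rfl h1, Finset.sum_range_sub']
  have : F R = 0 := by
    simp only [hF]
    rw [← choose_two_mul_mul, Nat.choose_eq_zero_of_lt (by omega)]
    simp
  rw [this]
  simp [hF]
  ring

/-- The indices `2, 4, …, 2 * R`. -/
def evenIdx (R : ℕ) : Finset ℕ := (Finset.range R).image fun κ => 2 * κ + 2

lemma sum_evenIdx {M : Type*} [AddCommMonoid M] (R : ℕ) (f : ℕ → M) :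
    ∑ k ∈ evenIdx R, f k = ∑ κ ∈ Finset.range R, f (2 * κ + 2) :=
  Finset.sum_image fun _ _ _ _ h => by simpa using h

/-- Normalisation of the linear statistic of `x ^ (2 * a ^ 2)`. -/
def testNorm (a : ℕ) : ℝ := (2 * a ^ 2).choose (a ^ 2) * a / √2

/-- Coefficients of the linear statistic of `x ^ (2 * a ^ 2)`, normalised to have limiting
variance one. -/
def testCoef (a k : ℕ) : ℝ := (2 * a ^ 2).choose (a ^ 2 + k / 2) / testNorm a

lemma testNorm_pos {a : ℕ} (ha : 0 < a) : 0 < testNorm a := by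
  have : 0 < (2 * a ^ 2).choose (a ^ 2) := Nat.choose_pos (by omega)
  unfold testNorm
  positivity

lemma covForm_testCoef {a b R : ℕ} (ha : 0 < a) (hb : 0 < b) (h : a ^ 2 ≤ R) :
    covForm (evenIdx R) (testCoef a) (testCoef b) = 2 * (a * b) / (a ^ 2 + b ^ 2) := by
  have key := sum_choose_mul_choose (Q := b ^ 2) h
  have h1 : ((2 * a ^ 2).choose (a ^ 2) : ℝ) ≠ 0 := by
    exact_mod_cast (Nat.choose_pos (by omega)).ne'
  have h2 : ((2 * b ^ 2).choose (b ^ 2) : ℝ) ≠ 0 := by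
    exact_mod_cast (Nat.choose_pos (by omega)).ne'
  have h3 : (a : ℝ) ^ 2 + b ^ 2 ≠ 0 := by positivity
  have ha' : (a : ℝ) ≠ 0 := by positivity
  have hb' : (b : ℝ) ≠ 0 := by positivity
  have e : covForm (evenIdx R) (testCoef a) (testCoef b) * (testNorm a * testNorm b)
        * (a ^ 2 + b ^ 2)
      = a ^ 2 * b ^ 2 * ((2 * a ^ 2).choose (a ^ 2) * (2 * b ^ 2).choose (b ^ 2)) := by
    push_cast at key
    rw [← key, covForm, sum_evenIdx, Finset.sum_mul, Finset.sum_mul]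
    refine Finset.sum_congr rfl fun κ _ => ?_
    have := (testNorm_pos ha).ne'
    have := (testNorm_pos hb).ne'
    rw [testCoef, testCoef, show (2 * κ + 2) / 2 = κ + 1 by omega]
    field_simp
    push_cast
    ring
  have e2 : testNorm a * testNorm b = ((2 * a ^ 2).choose (a ^ 2) : ℝ) * (2 * b ^ 2).choose (b ^ 2)
      * (a * b) / 2 := by
    have : √2 * √2 = 2 := Real.mul_self_sqrt (by norm_num)
    rw [testNorm, testNorm, div_mul_div_comm, this]
    ring
  rw [e2] at e
  field_simp
  have : (((2 * a ^ 2).choose (a ^ 2) : ℝ) * (2 * b ^ 2).choose (b ^ 2)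
      * (a * b)) ≠ 0 := by positivity
  refine mul_left_cancel₀ this ?_
  linear_combination 2 * e

end TestCoefficients

section WishartFamily

open Matrix

/-- Shapes of wide nonempty matrices. -/
abbrev WideShape := {p : ℕ × ℕ // 0 < p.1 ∧ p.1 ≤ p.2}

namespace WideShape

lemma cast_fst_pos (θ : WideShape) : (0 : ℝ) < θ.1.1 := by exact_mod_cast θ.2.1

lemma cast_snd_pos (θ : WideShape) : (0 : ℝ) < θ.1.2 := by
  exact_mod_cast θ.2.1.trans_le θ.2.2

/-- The square root of the aspect ratio. -/
def ratio (θ : WideShape) : ℝ := √(θ.1.1 / θ.1.2)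

/-- The inverse of the dimension. -/
def invDim (θ : WideShape) : ℝ := 1 / θ.1.1

lemma ratio_pos (θ : WideShape) : 0 < ratio θ :=
  Real.sqrt_pos.mpr (div_pos θ.cast_fst_pos θ.cast_snd_pos)

lemma mul_ratio_sq (θ : WideShape) : θ.1.2 * ratio θ ^ 2 = θ.1.1 := by
  rw [ratio, Real.sq_sqrt (div_pos θ.cast_fst_pos θ.cast_snd_pos).le,
    mul_div_cancel₀ _ θ.cast_snd_pos.ne']

lemma ratio_le_one (θ : WideShape) : ratio θ ≤ 1 := by
  rw [ratio, Real.sqrt_le_one, div_le_one θ.cast_snd_pos]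
  exact_mod_cast θ.2.2

lemma bounded_ratio : ∃ K, ∀ θ : WideShape, |ratio θ| ≤ K :=
  ⟨1, fun θ => by rw [abs_of_pos θ.ratio_pos]; exact θ.ratio_le_one⟩

lemma invDim_pos (θ : WideShape) : 0 < invDim θ := div_pos one_pos θ.cast_fst_pos

lemma invDim_le_one (θ : WideShape) : invDim θ ≤ 1 := by
  rw [invDim, div_le_one θ.cast_fst_pos]
  exact_mod_cast θ.2.1

lemma bounded_invDim : ∃ K, ∀ θ : WideShape, |invDim θ| ≤ K :=
  ⟨1, fun θ => by rw [abs_of_pos θ.invDim_pos]; exact θ.invDim_le_one⟩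

/-- The space of matrices of a given shape. -/
abbrev Mat (θ : WideShape) : Type := Matrix (Fin θ.1.1) (Fin θ.1.2) ℂ

/-- The Gaussian measure on matrices of a given shape. -/
abbrev gauss (θ : WideShape) : Measure (Mat θ) := gaussMatrix θ.1.1 θ.1.2

end WideShape

open WideShape

/-- The scaled and centred Wishart matrix. -/
def centredW (p : Σ θ : WideShape, Mat θ) : Matrix (Fin p.1.1.1) (Fin p.1.1.1) ℂ :=
  scaledW (ratio p.1) (p.2 * p.2ᴴ)

/-- The centred Chebyshev statistics of Wishart matrices. -/
def wishartFam (k : ℕ) (p : Σ θ : WideShape, Mat θ) : ℝ :=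
  realTrace (ratio p.1) (p.2 * p.2ᴴ) k

lemma ofReal_wishartFam (k : ℕ) (p : Σ θ : WideShape, Mat θ) :
    (wishartFam k p : ℂ) = chebTrace (centredW p) (ratio p.1 : ℂ) k :=
  ofReal_realTrace _ (isHermitian_mul_conjTranspose_self _) k

theorem schwingerDysonFamily_wishartFam :
    SchwingerDysonFamily gauss wishartFam ratio invDim where
  bounded_left := bounded_ratio
  bounded_right := bounded_invDim
  zero := by
    ext p
    simp [wishartFam, realTrace, chebTrace]
  integrable θ L := by
    refine (integrable_prod_realTrace (ratio θ) L).congr (.of_forall fun G => ?_)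
    have := map_list_prod (Pi.evalRingHom (fun _ : (Σ θ : WideShape, Mat θ) => ℝ) ⟨θ, G⟩)
      (L.map wishartFam)
    rw [List.map_map] at this
    exact this.symm
  integral_eq θ k L := by
    have key := integral_realTrace_mul_prod θ.2.1.ne' θ.ratio_pos.ne' θ.mul_ratio_sq k L
    let ev (G : Mat θ) := Pi.evalRingHom (fun _ : (Σ θ : WideShape, Mat θ) => ℝ) ⟨θ, G⟩
    have e1 (G : Mat θ) : (L.map wishartFam).prod ⟨θ, G⟩
        = (L.map (realTrace (ratio θ) (G * Gᴴ))).prod :=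
      (map_list_prod (ev G) (L.map wishartFam)).trans (by rw [List.map_map]; rfl)
    have e2 (G : Mat θ) (k : ℕ) : weightedZ (ofParam ratio) wishartFam k ⟨θ, G⟩
        = weightedZ (ratio θ) (realTrace (ratio θ) (G * Gᴴ)) k :=
      map_weightedZ (ofParam ratio) wishartFam (ev G) k
    have e3 (G : Mat θ) (k : ℕ) : chebZ wishartFam k ⟨θ, G⟩
        = chebZ (realTrace (ratio θ) (G * Gᴴ)) k :=
      map_chebZ wishartFam (ev G) k
    have e4 (G : Mat θ) :
        listDeriv wishartFam (carre (ofParam ratio) (ofParam invDim) wishartFam k) L ⟨θ, G⟩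
        = listDeriv (realTrace (ratio θ) (G * Gᴴ))
          (carre (ratio θ) (1 / θ.1.1) (realTrace (ratio θ) (G * Gᴴ)) k) L :=
      (map_listDeriv wishartFam (ev G) _ L).trans (by simp only [map_carre]; rfl)
    simp only [Pi.add_apply, Pi.mul_apply, Finset.sum_apply, e1, e2, e3, e4]
    exact key

/-- Bounded by a polynomial in the Chebyshev statistics. -/
abbrev wishartAlg : Subalgebra ℝ ((Σ θ : WideShape, Mat θ) → ℝ) := polyAlg wishartFam

lemma re_trace_chebU (k : ℕ) (p : Σ θ : WideShape, Mat θ) :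
    (trace (chebU (centredW p) k)).re
      = chebZ wishartFam k p + p.1.1.1 * chebMean (ratio p.1) k := by
  have h1 : ((chebMean (ratio p.1) k : ℝ) : ℂ) = chebMean (ratio p.1 : ℂ) k := by
    cases k <;> simp [chebMean]
  have h2 : ((chebZ wishartFam k p : ℝ) : ℂ) = chebZ (chebTrace (centredW p) (ratio p.1)) k := by
    have := map_chebZ wishartFam (Complex.ofRealHom.comp
      (Pi.evalRingHom (fun _ : (Σ θ : WideShape, Mat θ) => ℝ) p)) k
    simp only [RingHom.comp_apply, Pi.evalRingHom_apply, Complex.ofRealHom_eq_coe,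
      ofReal_wishartFam] at this
    exact this
  rw [trace_chebU (centredW p) (ratio p.1 : ℂ) k, ← h1, ← h2]
  simp

lemma re_trace_weight_mul_chebU {k : ℕ} (hk : k ≠ 1) (p : Σ θ : WideShape, Mat θ) :
    (trace (weight (centredW p) (ratio p.1 : ℂ) * chebU (centredW p) k)).re
      = weightedZ (ofParam ratio) wishartFam k p := by
  have h2 : ((weightedZ (ofParam ratio) wishartFam k p : ℝ) : ℂ)
      = weightedZ (ratio p.1 : ℂ) (chebTrace (centredW p) (ratio p.1)) k := by
    have := map_weightedZ (ofParam ratio) wishartFam (Complex.ofRealHom.comp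
      (Pi.evalRingHom (fun _ : (Σ θ : WideShape, Mat θ) => ℝ) p)) k
    simp only [RingHom.comp_apply, Pi.evalRingHom_apply, Complex.ofRealHom_eq_coe,
      ofReal_wishartFam] at this
    exact this
  rw [trace_weight_mul_chebU, ← h2, if_neg hk]
  simp

lemma bounded_chebMean (k : ℕ) : ∃ K, ∀ θ : WideShape, |chebMean (ratio θ) k| ≤ K := by
  refine ⟨1, fun θ => ?_⟩
  cases k with
  | zero => simp [chebMean]
  | succ k =>
    rw [chebMean, abs_pow, abs_neg, abs_of_pos θ.ratio_pos]
    exact pow_le_one₀ θ.ratio_pos.le θ.ratio_le_one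

lemma pow_succ_mul_chebU_succ {A : Type*} [Ring A] (b : A) (q k : ℕ) :
    b ^ (q + 1) * chebU b (k + 1) = b ^ q * chebU b (k + 2) + b ^ q * chebU b k := by
  rw [pow_succ, mul_assoc, mul_chebU_succ, mul_add]

lemma invDim_mul_re_trace_pow_mul_chebU_mem (q k : ℕ) :
    (fun p => invDim p.1 * (trace (centredW p ^ q * chebU (centredW p) k)).re) ∈ wishartAlg := by
  induction q generalizing k with
  | zero =>
    convert add_mem (mul_mem (coeff_mem_polyAlg (Y := wishartFam) bounded_invDim)
      (chebZ_mem_polyAlg k)) (coeff_mem_polyAlg (bounded_chebMean k)) using 1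
    ext p
    have := p.1.cast_fst_pos.ne'
    simp only [pow_zero, one_mul, re_trace_chebU, Pi.add_apply, Pi.mul_apply, ofParam_apply, invDim]
    field_simp
  | succ q ih =>
    cases k with
    | zero =>
      simp only [chebU_zero, mul_zero, trace_zero, Complex.zero_re]
      exact zero_mem wishartAlg
    | succ k =>
      convert add_mem (ih (k + 2)) (ih k) using 1
      ext p
      simp only [pow_succ_mul_chebU_succ, trace_add, Complex.add_re, Pi.add_apply]
      ring

lemma invDim_mul_re_trace_pow_mem (q : ℕ) :
    (fun p => invDim p.1 * (trace (centredW p ^ q)).re) ∈ wishartAlg := by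
  simpa using invDim_mul_re_trace_pow_mul_chebU_mem q 1

lemma re_trace_weight_mul_pow_mul_chebU_mem {q k : ℕ} (h : Even (q + k)) :
    (fun p => (trace (weight (centredW p) (ratio p.1 : ℂ) *
      (centredW p ^ q * chebU (centredW p) k))).re) ∈ wishartAlg := by
  induction q generalizing k with
  | zero =>
    have hk : k ≠ 1 := by rintro rfl; simp at h
    simp only [pow_zero, one_mul, re_trace_weight_mul_chebU hk]
    exact ⟨k, weightedZ_mem_polyFam bounded_ratio k⟩
  | succ q ih =>
    cases k with
    | zero =>
      simp only [chebU_zero, mul_zero, trace_zero, Complex.zero_re]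
      exact zero_mem wishartAlg
    | succ k =>
      have h' : Even (q + k) := by
        rw [show q + 1 + (k + 1) = q + k + 2 by ring] at h
        simpa [Nat.even_add] using h
      convert add_mem (ih (k := k + 2) (by rw [← add_assoc]; simpa [Nat.even_add] using h'))
        (ih h') using 1
      ext p
      simp only [pow_succ_mul_chebU_succ, mul_add, trace_add, Complex.add_re, Pi.add_apply]

lemma re_trace_weight_mul_pow_mem {q : ℕ} (h : Odd q) :
    (fun p => (trace (weight (centredW p) (ratio p.1 : ℂ) * centredW p ^ q)).re) ∈ wishartAlg := by
  simpa using re_trace_weight_mul_pow_mul_chebU_mem (q := q) (k := 1) h.add_one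

end WishartFamily

section TraceNormalisation

open Matrix

/-- The trace of an even power of an affine image of `M`. -/
def testStat {n : ℕ} (N s : ℝ) (P : ℕ) (M : Matrix (Fin n) (Fin n) ℂ) : ℝ :=
  (trace (((N : ℂ) • M - (s : ℂ) • 1) ^ (2 * P))).re

/-- The typical scale of the inverse of the spectrum of a trace-normalised Wishart matrix. -/
def specScale (n m : ℕ) : ℝ := √(n * m)

/-- The centre of the scaled spectrum. -/
def specShift (n m : ℕ) : ℝ := √(n / m) + √(m / n)

/-- Normalisation of a matrix by its trace. -/
def traceNorm {n : ℕ} (M : Matrix (Fin n) (Fin n) ℂ) : Matrix (Fin n) (Fin n) ℂ :=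
  (trace M)⁻¹ • M

open WideShape

lemma specScale_eq (θ : WideShape) : specScale θ.1.1 θ.1.2 = θ.1.1 / ratio θ := by
  have h := θ.cast_fst_pos
  have h' := θ.cast_snd_pos
  rw [specScale, eq_div_iff θ.ratio_pos.ne', ratio, ← Real.sqrt_mul (by positivity)]
  rw [show (θ.1.1 : ℝ) * θ.1.2 * (θ.1.1 / θ.1.2) = θ.1.1 ^ 2 by field_simp, Real.sqrt_sq h.le]

lemma specShift_eq (θ : WideShape) : specShift θ.1.1 θ.1.2 = ratio θ + (ratio θ)⁻¹ := by
  rw [specShift, ratio, ← Real.sqrt_inv, inv_div]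

/-- The fluctuation of the normalised trace. -/
def traceDev (p : Σ θ : WideShape, Mat θ) : ℝ := invDim p.1 * wishartFam 1 p

lemma ofReal_traceDev (p : Σ θ : WideShape, Mat θ) :
    (p.1.1.1 * traceDev p : ℂ) = trace (centredW p) + p.1.1.1 * (ratio p.1 : ℂ) := by
  have h : (p.1.1.1 : ℝ) * traceDev p = wishartFam 1 p := by
    have := p.1.cast_fst_pos.ne'
    rw [traceDev, invDim]
    field_simp
  rw [← Complex.ofReal_natCast, ← Complex.ofReal_mul, h, ofReal_wishartFam, chebTrace]
  simp [chebU, chebMean]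

lemma trace_mul_conjTranspose_eq (p : Σ θ : WideShape, Mat θ) :
    trace (p.2 * p.2ᴴ) * ((ratio p.1 / p.1.1.1 : ℝ) : ℂ)
      = (p.1.1.1 / ratio p.1 : ℝ) * (1 + ratio p.1 * traceDev p : ℝ) := by
  have h := ofReal_traceDev p
  have hr : (ratio p.1 : ℂ) ≠ 0 := by exact_mod_cast p.1.ratio_pos.ne'
  have hn : (p.1.1.1 : ℂ) ≠ 0 := by exact_mod_cast p.1.cast_fst_pos.ne'
  rw [centredW, scaledW, trace_sub, trace_smul, trace_smul, trace_one, Fintype.card_fin,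
    smul_eq_mul, smul_eq_mul] at h
  push_cast at h ⊢
  field_simp at h ⊢
  linear_combination -h

lemma smul_traceNorm_sub {p : Σ θ : WideShape, Mat θ} (h : 1 + ratio p.1 * traceDev p ≠ 0) :
    ((1 + ratio p.1 * traceDev p : ℝ) : ℂ) •
        ((specScale p.1.1.1 p.1.1.2 : ℂ) • traceNorm (p.2 * p.2ᴴ)
          - (specShift p.1.1.1 p.1.1.2 : ℂ) • 1)
      = centredW p - (((1 + ratio p.1 ^ 2) * traceDev p : ℝ) : ℂ) • 1 := by
  have key := trace_mul_conjTranspose_eq p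
  have hr : (ratio p.1 : ℂ) ≠ 0 := by exact_mod_cast p.1.ratio_pos.ne'
  have hn : (p.1.1.1 : ℂ) ≠ 0 := by exact_mod_cast p.1.cast_fst_pos.ne'
  have hD : ((1 + ratio p.1 * traceDev p : ℝ) : ℂ) ≠ 0 := by exact_mod_cast h
  have hτ : trace (p.2 * p.2ᴴ) ≠ 0 := by
    intro h0
    rw [h0, zero_mul, Complex.ofReal_div, Complex.ofReal_natCast] at key
    exact mul_ne_zero (div_ne_zero hn hr) hD key.symm
  rw [specScale_eq, specShift_eq, traceNorm, centredW, scaledW, smul_sub, smul_smul, smul_smul,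
    smul_smul, sub_sub, ← add_smul]
  congr 2
  · field_simp
    push_cast at key ⊢
    field_simp at key ⊢
    linear_combination -key
  · push_cast
    field_simp
    ring

/-- Trace of a power of the centred Wishart matrix. -/
def powTrace (q : ℕ) (p : Σ θ : WideShape, Mat θ) : ℝ := (trace (centredW p ^ q)).re

lemma ofReal_powTrace (q : ℕ) (p : Σ θ : WideShape, Mat θ) :
    (powTrace q p : ℂ) = trace (centredW p ^ q) :=
  ofReal_re_trace ((isHermitian_scaledW _ (isHermitian_mul_conjTranspose_self _)).pow q)

/-- The error made by trace normalisation. -/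
def normErr (P : ℕ) (p : Σ θ : WideShape, Mat θ) : ℝ :=
  ∑ j ∈ Finset.range (2 * P), (2 * P).choose (j + 1) * (traceDev p ^ (j + 1) *
    ((-(1 + ratio p.1 ^ 2)) ^ (j + 1) * powTrace (2 * P - (j + 1)) p
      - ratio p.1 ^ (j + 1) * powTrace (2 * P) p))

lemma testStat_traceNorm {p : Σ θ : WideShape, Mat θ} (h : 1 + ratio p.1 * traceDev p ≠ 0)
    (P : ℕ) :
    (1 + ratio p.1 * traceDev p) ^ (2 * P) * (testStat (specScale p.1.1.1 p.1.1.2)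
        (specShift p.1.1.1 p.1.1.2) P (traceNorm (p.2 * p.2ᴴ)) - powTrace (2 * P) p)
      = normErr P p := by
  set D := 1 + ratio p.1 * traceDev p with hD
  set v := -((1 + ratio p.1 ^ 2) * traceDev p) with hv
  have h1 : D ^ (2 * P) * testStat (specScale p.1.1.1 p.1.1.2)
        (specShift p.1.1.1 p.1.1.2) P (traceNorm (p.2 * p.2ᴴ))
      = ∑ j ∈ Finset.range (2 * P + 1), v ^ j * powTrace (2 * P - j) p * (2 * P).choose j := by
    have e : (v : ℂ) • (1 : Matrix (Fin p.1.1.1) (Fin p.1.1.1) ℂ) + centredW p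
        = (D : ℂ) • ((specScale p.1.1.1 p.1.1.2 : ℂ) • traceNorm (p.2 * p.2ᴴ)
          - (specShift p.1.1.1 p.1.1.2 : ℂ) • 1) := by
      rw [smul_traceNorm_sub h, hv, Complex.ofReal_neg, neg_smul, neg_add_eq_sub]
    have e2 := congrArg (fun M => (trace (M ^ (2 * P))).re) e
    rw [smul_pow, trace_smul, smul_eq_mul, ← Complex.ofReal_pow, Complex.re_ofReal_mul] at e2
    rw [testStat, ← e2, Commute.add_pow ((Commute.one_left _).smul_left _), trace_sum,
      Complex.re_sum]
    refine Finset.sum_congr rfl fun j _ => ?_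
    rw [smul_pow, one_pow, smul_mul_assoc, one_mul, ← nsmul_eq_mul', smul_comm, trace_smul,
      trace_smul, ← ofReal_powTrace, smul_eq_mul, nsmul_eq_mul, ← Complex.ofReal_pow,
      ← Complex.ofReal_natCast, ← Complex.ofReal_mul, ← Complex.ofReal_mul, Complex.ofReal_re]
    ring
  have h2 : D ^ (2 * P) * powTrace (2 * P) p = ∑ j ∈ Finset.range (2 * P + 1),
      (ratio p.1 * traceDev p) ^ j * powTrace (2 * P) p * (2 * P).choose j := by
    rw [hD, add_comm, add_pow, Finset.sum_mul]
    refine Finset.sum_congr rfl fun j _ => ?_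
    rw [one_pow]
    ring
  rw [mul_sub, h1, h2, ← Finset.sum_sub_distrib, Finset.sum_range_succ']
  simp only [pow_zero, tsub_zero, sub_self, add_zero]
  refine Finset.sum_congr rfl fun j _ => ?_
  rw [hv, ← neg_mul, mul_pow, mul_pow]
  ring

lemma invDim_mul_powTrace_mem (q : ℕ) : ofParam invDim * powTrace q ∈ wishartAlg :=
  invDim_mul_re_trace_pow_mem q

lemma weighted_powTrace_mem {q : ℕ} (hq : Odd q) :
    (fun p => (1 + ratio p.1 ^ 2) * powTrace q p + ratio p.1 * powTrace (q + 1) p)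
      ∈ wishartAlg := by
  convert re_trace_weight_mul_pow_mem hq using 2 with p
  rw [weight, Matrix.add_mul, smul_mul_assoc, Matrix.one_mul, smul_mul_assoc, ← pow_succ',
      trace_add, trace_smul,
    trace_smul, ← ofReal_powTrace, ← ofReal_powTrace, smul_eq_mul, smul_eq_mul]
  norm_cast

lemma dim_mul_normErr_mem {P : ℕ} (hP : P ≠ 0) :
    (fun p => p.1.1.1 * normErr P p) ∈ wishartAlg := by
  have hr : ofParam ratio ∈ wishartAlg := coeff_mem_polyAlg bounded_ratio
  have hh : ofParam invDim ∈ wishartAlg := coeff_mem_polyAlg bounded_invDim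
  have hy : wishartFam 1 ∈ wishartAlg := self_mem_polyAlg 1
  have hc : ∀ c : ℝ, (fun _ => c) ∈ wishartAlg := fun c => Subalgebra.algebraMap_mem _ c
  obtain ⟨t, ht⟩ : ∃ t, 2 * P = t + 1 := ⟨2 * P - 1, by omega⟩
  have hodd : Odd t := by
    have : Even (t + 1) := ht ▸ even_two_mul P
    rcases Nat.even_or_odd t with h | h
    · exact absurd this (Nat.not_even_iff_odd.mpr h.add_one)
    · exact h
  have h0 := mul_mem (hc (2 * P)) (mul_mem hy (weighted_powTrace_mem hodd))
  have h1 : ∀ j ∈ Finset.range t, (fun _ => ((2 * P).choose (j + 1 + 1) : ℝ)) *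
      (wishartFam 1 ^ (j + 2) * ofParam invDim ^ j *
        ((-(1 + ofParam ratio ^ 2)) ^ (j + 2) * (ofParam invDim * powTrace (2 * P - (j + 1 + 1)))
          - ofParam ratio ^ (j + 2) * (ofParam invDim * powTrace (2 * P)))) ∈ wishartAlg :=
    fun j _ => mul_mem (hc _) (mul_mem (mul_mem (pow_mem hy _) (pow_mem hh _))
      (sub_mem (mul_mem (pow_mem (neg_mem (add_mem (one_mem _) (pow_mem hr _))) _)
        (invDim_mul_powTrace_mem _)) (mul_mem (pow_mem hr _) (invDim_mul_powTrace_mem _))))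
  convert add_mem (sum_mem h1) (neg_mem h0) using 1
  ext p
  have hd : (p.1.1.1 : ℝ) * invDim p.1 = 1 := mul_one_div_cancel p.1.cast_fst_pos.ne'
  have hch : ((2 * P).choose (0 + 1) : ℝ) = 2 * P := by simp
  rw [normErr]
  have hrange : Finset.range (2 * P) = Finset.range (t + 1) := by rw [ht]
  rw [hrange, Finset.sum_range_succ', hch]
  simp only [Pi.add_apply, Pi.neg_apply, Pi.mul_apply, Finset.sum_apply, Pi.pow_apply,
    Pi.sub_apply, Pi.one_apply, ofParam_apply]
  rw [mul_add, Finset.mul_sum, show 2 * P - (0 + 1) = t by omega, ← ht, zero_add, pow_one, pow_one,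
    pow_one, traceDev]
  congr 1
  · refine Finset.sum_congr rfl fun j _ => ?_
    rw [show j + 1 + 1 = j + 2 by ring, mul_pow, pow_add (invDim p.1) j 2]
    linear_combination ((2 * P).choose (j + 2) * (invDim p.1 ^ j * invDim p.1 *
        wishartFam 1 p ^ (j + 2)) *
      ((-(1 + ratio p.1 ^ 2)) ^ (j + 2) * powTrace (2 * P - (j + 2)) p
        - ratio p.1 ^ (j + 2) * powTrace (2 * P) p)) * hd
  · linear_combination (2 * P * wishartFam 1 p * (-(1 + ratio p.1 ^ 2) * powTrace t p
      - ratio p.1 * powTrace (2 * P) p)) * hd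

lemma powTrace_two_mul (P R : ℕ) (h : P ≤ R) (p : Σ θ : WideShape, Mat θ) :
    powTrace (2 * P) p = p.1.1.1 * evenMean (ratio p.1) P
      + ∑ κ ∈ Finset.range R, ((2 * P).choose (P + (κ + 1)) : ℝ) * wishartFam (2 * κ + 2) p := by
  have h1 : ∀ k, ((chebMean (ratio p.1) k : ℝ) : ℂ) = chebMean (ratio p.1 : ℂ) k := fun k => by
    cases k <;> simp [chebMean]
  have h2 := trace_pow_two_mul (centredW p) (ratio p.1 : ℂ) h
  rw [← ofReal_powTrace] at h2
  simp only [evenMean, ← ofReal_wishartFam, ← h1] at h2 ⊢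
  exact_mod_cast h2

lemma powTrace_two_mul_sq {a R : ℕ} (ha : 0 < a) (h : a ^ 2 ≤ R) (p : Σ θ : WideShape, Mat θ) :
    powTrace (2 * a ^ 2) p = p.1.1.1 * evenMean (ratio p.1) (a ^ 2)
      + testNorm a * linFam wishartFam (evenIdx R) (testCoef a) p := by
  rw [powTrace_two_mul _ R h, linFam, Finset.sum_apply, sum_evenIdx, Finset.mul_sum]
  congr 1
  refine Finset.sum_congr rfl fun κ _ => ?_
  have := (testNorm_pos ha).ne'
  rw [Pi.smul_apply, smul_eq_mul, testCoef, show (2 * κ + 2) / 2 = κ + 1 by omega]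
  field_simp

lemma one_add_ratio_mul_traceDev_ge {p : Σ θ : WideShape, Mat θ} (h : |traceDev p| ≤ 1 / 2) :
    1 / 2 ≤ 1 + ratio p.1 * traceDev p := by
  have : |ratio p.1 * traceDev p| ≤ 1 / 2 := by
    rw [abs_mul, abs_of_pos p.1.ratio_pos]
    nlinarith [p.1.ratio_pos, p.1.ratio_le_one, abs_nonneg (traceDev p)]
  linarith [(abs_le.mp this).1]

lemma abs_testStat_traceNorm_sub_le {p : Σ θ : WideShape, Mat θ} (h : |traceDev p| ≤ 1 / 2)
    (P : ℕ) :
    |testStat (specScale p.1.1.1 p.1.1.2) (specShift p.1.1.1 p.1.1.2) P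
        (traceNorm (p.2 * p.2ᴴ)) - powTrace (2 * P) p| ≤ 4 ^ P * |normErr P p| := by
  have hD := one_add_ratio_mul_traceDev_ge h
  have h1 : (1 / 4 : ℝ) ^ P ≤ (1 + ratio p.1 * traceDev p) ^ (2 * P) := by
    rw [pow_mul]
    exact pow_le_pow_left₀ (by norm_num) (by nlinarith) P
  rw [← testStat_traceNorm (by linarith) P, abs_mul,
    abs_of_pos (a := (1 + ratio p.1 * traceDev p) ^ (2 * P)) (pow_pos (by linarith) _), ← mul_assoc]
  refine le_mul_of_one_le_left (abs_nonneg _) ?_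
  calc (1 : ℝ) = 4 ^ P * (1 / 4) ^ P := by rw [← mul_pow]; norm_num
    _ ≤ _ := by gcongr

end TraceNormalisation

section Majorant

lemma sum_ge_of_moments {K : ℕ} {x : ℕ → ℝ} {s : ℝ} (hs : 0 < s)
    (hx : ∀ i ∈ Finset.range K, -(1 / (8 * s)) ≤ x i)
    (h2 : (K : ℝ) ≤ ∑ i ∈ Finset.range K, x i ^ 2)
    (h4 : ∑ i ∈ Finset.range K, x i ^ 2 * x i ^ 2 ≤ s ^ 2 * K) :
    K / (2 * s) ≤ ∑ i ∈ Finset.range K, x i := by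
  have h1 : ∀ i ∈ Finset.range K, 3 / (2 * s) * x i ^ 2 - 1 / (2 * s ^ 3) * (x i ^ 2 * x i ^ 2)
      - 1 / (4 * s) ≤ x i := fun i hi => by
    have ha : |x i| ≤ x i + 1 / (4 * s) := by
      have := hx i hi
      have e : 1 / (4 * s) = 2 * (1 / (8 * s)) := by field_simp; norm_num
      have : 0 < 1 / (8 * s) := by positivity
      rcases abs_cases (x i) with ⟨h, _⟩ | ⟨h, _⟩ <;> rw [h] <;> linarith
    have hb : 3 / (2 * s) * x i ^ 2 - 1 / (2 * s ^ 3) * (x i ^ 2 * x i ^ 2) ≤ |x i| := by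
      have h0 : 0 ≤ |x i| / s * (|x i| / s - 1) ^ 2 * (|x i| / s + 2) := by positivity
      rw [← sq_abs (x i)]
      have e : |x i| - (3 / (2 * s) * |x i| ^ 2 - 1 / (2 * s ^ 3) * (|x i| ^ 2 * |x i| ^ 2))
          = s / 2 * (|x i| / s * (|x i| / s - 1) ^ 2 * (|x i| / s + 2)) := by
        field_simp
        ring
      have : 0 ≤ s / 2 * (|x i| / s * (|x i| / s - 1) ^ 2 * (|x i| / s + 2)) := by positivity
      linarith
    linarith
  have h3 := Finset.sum_le_sum h1
  rw [Finset.sum_sub_distrib, Finset.sum_sub_distrib, ← Finset.mul_sum, ← Finset.mul_sum,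
    Finset.sum_const, Finset.card_range, nsmul_eq_mul] at h3
  refine le_trans ?_ h3
  have e1 : 3 / (2 * s) * K ≤ 3 / (2 * s) * ∑ i ∈ Finset.range K, x i ^ 2 := by gcongr
  have e2 : 1 / (2 * s ^ 3) * ∑ i ∈ Finset.range K, x i ^ 2 * x i ^ 2
      ≤ 1 / (2 * s ^ 3) * (s ^ 2 * K) := by gcongr
  have e3 : (K : ℝ) / (2 * s) = 3 / (2 * s) * K - 1 / (2 * s ^ 3) * (s ^ 2 * K)
      - 2 * (K * (1 / (4 * s))) := by
    field_simp
    ring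
  have e4 : 0 ≤ (K : ℝ) * (1 / (4 * s)) := by positivity
  linarith

lemma two_mul_div_add_sq_le {K : ℕ} (hK : 0 < K) {i j : ℕ} (hij : i ≠ j) :
    2 * (((2 * K) ^ i : ℕ) * ((2 * K) ^ j : ℕ)) / ((((2 * K) ^ i : ℕ) : ℝ) ^ 2
      + (((2 * K) ^ j : ℕ) : ℝ) ^ 2) ≤ 1 / K := by
  wlog h : i < j generalizing i j
  · have := this hij.symm (by omega)
    rwa [mul_comm (((2 * K) ^ i : ℕ) : ℝ), add_comm]
  obtain ⟨d, rfl⟩ := Nat.exists_eq_add_of_lt h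
  have hK' : (1 : ℝ) ≤ K := by exact_mod_cast hK
  have ha : 0 < (2 * K : ℝ) ^ i := by positivity
  have hb : 1 ≤ (2 * K : ℝ) ^ d := one_le_pow₀ (by linarith)
  push_cast
  rw [pow_succ, pow_add, div_le_div_iff₀ (by positivity) (by positivity)]
  set a := (2 * K : ℝ) ^ i
  set b := (2 * K : ℝ) ^ d
  have : 0 ≤ a ^ 2 * (b - 1) * b := by
    have : 0 ≤ b - 1 := by linarith
    positivity
  have h4 : 4 * (K : ℝ) ^ 2 * (a ^ 2 * b) ≤ 4 * (K : ℝ) ^ 2 * (a ^ 2 * b ^ 2) := by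
    gcongr
    nlinarith
  nlinarith [sq_nonneg a]

variable {Θ : Type*} {Ω : Θ → Type*} [∀ θ, MeasurableSpace (Ω θ)]
  {μ : ∀ θ, Measure (Ω θ)} [∀ θ, IsProbabilityMeasure (μ θ)] {Y : ℕ → (Σ θ, Ω θ) → ℝ}
  {r h : Θ → ℝ}

lemma SchwingerDysonFamily.meanTendsto_sq_zero (H : SchwingerDysonFamily μ Y r h) {l : Filter Θ}
    (hl : Tendsto h l (𝓝 0)) {f g : (Σ θ, Ω θ) → ℝ} (hg : g ∈ polyAlg Y)
    (hf : f = ofParam h * g) : MeanTendsto μ l (f ^ 2) 0 := by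
  have hm : ofParam h * g ^ 2 ∈ polyAlg Y :=
    mul_mem (coeff_mem_polyAlg H.bounded_right) (pow_mem hg 2)
  have e : f ^ 2 = ofParam h * (ofParam h * g ^ 2) := by rw [hf]; ring
  refine ⟨fun θ => ?_, ?_⟩
  · rw [e]
    exact H.integrable_of_mem (mul_mem (coeff_mem_polyAlg H.bounded_right) hm) θ
  · refine (H.tendsto_mul_integral hl hm).congr fun θ => ?_
    rw [e, ← integral_const_mul]
    rfl

/-- The sum of two independent copies of `f`. -/
def copySum (f : (Σ θ, Ω θ) → ℝ) : (Σ θ, Ω θ × Ω θ) → ℝ :=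
  fun p => f ⟨p.1, p.2.1⟩ + f ⟨p.1, p.2.2⟩

lemma MeanTendsto.copySum {l : Filter Θ} {f : (Σ θ, Ω θ) → ℝ} {x : ℝ}
    (hf : MeanTendsto μ l f x) :
    MeanTendsto (fun θ => (μ θ).prod (μ θ)) l (copySum f) (2 * x) := by
  have h1 := MeanTendsto.one (μ := μ) (l := l)
  convert (hf.tensor_tendsto h1).add (h1.tensor_tendsto hf) using 1
  · ext p
    simp [_root_.copySum, MeanTendsto.tensor]
  · ring

/-- The scales of the test statistics. -/
def testScale (K i : ℕ) : ℕ := (2 * K) ^ i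

lemma testScale_pos {K : ℕ} (hK : 0 < K) (i : ℕ) : 0 < testScale K i := by
  unfold testScale
  positivity

lemma testScale_sq_le {K : ℕ} (hK : 0 < K) {i : ℕ} (hi : i < K) :
    testScale K i ^ 2 ≤ (2 * K) ^ (2 * K) := by
  rw [testScale, ← pow_mul]
  exact Nat.pow_le_pow_right (by omega) (by omega)

/-- The limiting covariances of the test statistics. -/
def testCov (K i j : ℕ) : ℝ :=
  covForm (evenIdx ((2 * K) ^ (2 * K))) (testCoef (testScale K i)) (testCoef (testScale K j))

lemma testCov_self {K : ℕ} (hK : 0 < K) {i : ℕ} (hi : i < K) : testCov K i i = 1 := by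
  have := testScale_pos hK i
  rw [testCov, covForm_testCoef (testScale_pos hK i) (testScale_pos hK i) (testScale_sq_le hK hi)]
  field_simp
  norm_num

lemma testCov_nonneg {K : ℕ} (hK : 0 < K) {i : ℕ} (hi : i < K) (j : ℕ) : 0 ≤ testCov K i j := by
  rw [testCov, covForm_testCoef (testScale_pos hK i) (testScale_pos hK j) (testScale_sq_le hK hi)]
  positivity

lemma testCov_le {K : ℕ} (hK : 0 < K) {i j : ℕ} (hi : i < K) (hij : i ≠ j) :
    testCov K i j ≤ 1 / K := by
  rw [testCov, covForm_testCoef (testScale_pos hK i) (testScale_pos hK j) (testScale_sq_le hK hi)]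
  exact two_mul_div_add_sq_le hK hij

lemma sum_testCov_le {K : ℕ} (hK : 0 < K) :
    ∑ i ∈ Finset.range K, ∑ j ∈ Finset.range K, testCov K i j ≤ 2 * K := by
  have : ∀ i ∈ Finset.range K, ∑ j ∈ Finset.range K, testCov K i j ≤ 2 := fun i hi => by
    rw [Finset.mem_range] at hi
    calc ∑ j ∈ Finset.range K, testCov K i j
        ≤ ∑ j ∈ Finset.range K, ((if i = j then 1 else 0) + 1 / (K : ℝ)) := by
          refine Finset.sum_le_sum fun j _ => ?_
          split_ifs with h
          · rw [← h, testCov_self hK hi]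
            exact le_add_of_nonneg_right (by positivity)
          · rw [zero_add]
            exact testCov_le hK hi h
      _ = 2 := by
          have : (K : ℝ) ≠ 0 := by positivity
          rw [Finset.sum_add_distrib, Finset.sum_ite_eq, if_pos (Finset.mem_range.mpr hi)]
          simp only [Finset.sum_const, Finset.card_range, nsmul_eq_mul]
          field_simp
          norm_num
  calc _ ≤ ∑ i ∈ Finset.range K, (2 : ℝ) := Finset.sum_le_sum this
    _ = 2 * K := by simp [mul_comm]

lemma sum_testCov_sq_le {K : ℕ} (hK : 0 < K) :
    ∑ i ∈ Finset.range K, ∑ j ∈ Finset.range K, testCov K i j ^ 2 ≤ 2 * K := by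
  refine le_trans (Finset.sum_le_sum fun i hi => Finset.sum_le_sum fun j _ => ?_)
    (sum_testCov_le hK)
  rw [Finset.mem_range] at hi
  have h0 := testCov_nonneg hK hi j
  have h1 : testCov K i j ≤ 1 := by
    rcases eq_or_ne i j with rfl | h
    · exact (testCov_self hK hi).le
    · exact (testCov_le hK hi h).trans (by
        rw [div_le_one (by positivity)]
        exact_mod_cast hK)
  nlinarith

/-- The test statistics. -/
def testFam (Y : ℕ → (Σ θ, Ω θ) → ℝ) (K i : ℕ) : (Σ θ, Ω θ) → ℝ :=
  linFam Y (evenIdx ((2 * K) ^ (2 * K))) (testCoef (testScale K i))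

/-- A nonnegative family which is at least one wherever the differences of the test statistics
are all almost nonnegative. -/
def majorant (Y : ℕ → (Σ θ, Ω θ) → ℝ) (K : ℕ) (s : ℝ) : (Σ θ, Ω θ × Ω θ) → ℝ :=
  (1 / (s ^ 2 * K)) • (∑ i ∈ Finset.range K,
      copyDiff (testFam Y K i) ^ 2 * copyDiff (testFam Y K i) ^ 2)
    + ((1 / K : ℝ) • (∑ i ∈ Finset.range K, copyDiff (testFam Y K i) ^ 2) - 2) ^ 2
    + (4 * s ^ 2 / K ^ 2) • (∑ i ∈ Finset.range K, copyDiff (testFam Y K i)) ^ 2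

omit [∀ θ, MeasurableSpace (Ω θ)] in
lemma majorant_nonneg (K : ℕ) (s : ℝ) (p : Σ θ, Ω θ × Ω θ) : 0 ≤ majorant Y K s p := by
  simp only [majorant, Pi.add_apply, Pi.smul_apply, Pi.pow_apply, smul_eq_mul, Finset.sum_apply,
    Pi.mul_apply]
  positivity

omit [∀ θ, MeasurableSpace (Ω θ)] in
lemma one_le_majorant {K : ℕ} (hK : 0 < K) {s : ℝ} (hs : 0 < s) {p : Σ θ, Ω θ × Ω θ}
    (hp : ∀ i < K, -(1 / (8 * s)) ≤ copyDiff (testFam Y K i) p) : 1 ≤ majorant Y K s p := by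
  by_contra! h
  simp only [majorant, Pi.add_apply, Pi.smul_apply, Pi.pow_apply, smul_eq_mul, Finset.sum_apply,
    Pi.mul_apply, Pi.sub_apply, Pi.ofNat_apply] at h
  set x : ℕ → ℝ := fun i => copyDiff (testFam Y K i) p
  have hK' : (0 : ℝ) < K := by exact_mod_cast hK
  have t1 : 0 ≤ 1 / (s ^ 2 * K) * ∑ i ∈ Finset.range K, x i ^ 2 * x i ^ 2 := by positivity
  have t2 : 0 ≤ (1 / (K : ℝ) * ∑ i ∈ Finset.range K, x i ^ 2 - 2) ^ 2 := by positivity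
  have t3 : 0 ≤ 4 * s ^ 2 / K ^ 2 * (∑ i ∈ Finset.range K, x i) ^ 2 := by positivity
  change 1 / (s ^ 2 * K) * ∑ i ∈ Finset.range K, x i ^ 2 * x i ^ 2
    + (1 / (K : ℝ) * ∑ i ∈ Finset.range K, x i ^ 2 - 2) ^ 2
    + 4 * s ^ 2 / K ^ 2 * (∑ i ∈ Finset.range K, x i) ^ 2 < 1 at h
  have h4 : ∑ i ∈ Finset.range K, x i ^ 2 * x i ^ 2 ≤ s ^ 2 * K := by
    have : 1 / (s ^ 2 * K) * ∑ i ∈ Finset.range K, x i ^ 2 * x i ^ 2 ≤ 1 := by linarith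
    rw [one_div, inv_mul_le_iff₀ (by positivity), mul_one] at this
    exact this
  have h2 : (K : ℝ) ≤ ∑ i ∈ Finset.range K, x i ^ 2 := by
    have : 1 ≤ 1 / (K : ℝ) * ∑ i ∈ Finset.range K, x i ^ 2 := by nlinarith
    rwa [one_div, le_inv_mul_iff₀ hK', mul_one] at this
  have h3 := sum_ge_of_moments hs (fun i hi => hp i (Finset.mem_range.mp hi)) h2 h4
  have h5 : (K / (2 * s)) ^ 2 ≤ (∑ i ∈ Finset.range K, x i) ^ 2 := by gcongr
  have h6 : 4 * s ^ 2 / K ^ 2 * (K / (2 * s)) ^ 2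
      ≤ 4 * s ^ 2 / K ^ 2 * (∑ i ∈ Finset.range K, x i) ^ 2 := by gcongr
  have h7 : 4 * s ^ 2 / K ^ 2 * (K / (2 * s)) ^ 2 = 1 := by
    field_simp
    norm_num
  linarith

lemma SchwingerDysonFamily.exists_meanTendsto_majorant (H : SchwingerDysonFamily μ Y r h)
    {l : Filter Θ} (hl : Tendsto h l (𝓝 0)) {K : ℕ} (hK : 0 < K) {s : ℝ} (hs : 0 < s) :
    ∃ x ≤ 12 / s ^ 2 + 16 / K + 16 * s ^ 2 / K,
      MeanTendsto (fun θ => (μ θ).prod (μ θ)) l (majorant Y K s) x := by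
  have hK' : (0 : ℝ) < K := by exact_mod_cast hK
  have h22 (i : ℕ) (hi : i ∈ Finset.range K) (j : ℕ) (hj : j ∈ Finset.range K) :
      MeanTendsto (fun θ => (μ θ).prod (μ θ)) l
        (copyDiff (testFam Y K i) ^ 2 * copyDiff (testFam Y K j) ^ 2)
        (4 + 8 * testCov K i j ^ 2) := by
    have := H.meanTendsto_copyDiff_sq_mul_sq hl (evenIdx ((2 * K) ^ (2 * K)))
      (testCoef (testScale K i)) (testCoef (testScale K j))
    have e := testCov_self hK (Finset.mem_range.mp hi)
    have e' := testCov_self hK (Finset.mem_range.mp hj)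
    rw [testCov] at e e'
    rwa [e, e', one_mul, mul_one] at this
  have h11 (i j : ℕ) : MeanTendsto (fun θ => (μ θ).prod (μ θ)) l
        (copyDiff (testFam Y K i) * copyDiff (testFam Y K j)) (2 * testCov K i j) :=
    H.meanTendsto_copyDiff_mul hl _ _ _
  have m1 := (MeanTendsto.sum fun i hi => h22 i hi i hi).smul (1 / (s ^ 2 * K))
  have m2 := (MeanTendsto.sum fun i hi => MeanTendsto.sum fun j hj =>
    h22 i hi j hj).smul (1 / K ^ 2)
  have m3 := (MeanTendsto.sum (s := Finset.range K) fun i _ => h11 i i).smul (-4 / K)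
  have m4 := (MeanTendsto.one (μ := fun θ => (μ θ).prod (μ θ)) (l := l)).smul 4
  have m5 := (MeanTendsto.sum (s := Finset.range K) fun i _ =>
    MeanTendsto.sum (s := Finset.range K) fun j _ => h11 i j).smul (4 * s ^ 2 / K ^ 2)
  refine ⟨_, ?_, by
    convert (m1.add ((m2.add m3).add m4)).add m5 using 1
    rw [← Finset.sum_mul_sum, ← Finset.sum_mul_sum, majorant]
    ext p
    simp only [Pi.add_apply, Pi.smul_apply, Pi.pow_apply, smul_eq_mul, Finset.sum_apply,
      Pi.sub_apply, Pi.ofNat_apply, ← pow_two]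
    field_simp
    ring⟩
  have s1 : ∑ i ∈ Finset.range K, (4 + 8 * testCov K i i ^ 2) = 12 * (K : ℝ) := by
    rw [Finset.sum_congr rfl fun i hi => by rw [testCov_self hK (Finset.mem_range.mp hi)]]
    rw [Finset.sum_const, Finset.card_range, nsmul_eq_mul]
    ring
  have s2 : ∑ i ∈ Finset.range K, ∑ j ∈ Finset.range K, (4 + 8 * testCov K i j ^ 2)
      ≤ 4 * (K : ℝ) ^ 2 + 16 * K := by
    simp only [Finset.sum_add_distrib, ← Finset.mul_sum, Finset.sum_const, Finset.card_range,
      nsmul_eq_mul]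
    nlinarith [sum_testCov_sq_le hK]
  have s3 : ∑ i ∈ Finset.range K, 2 * testCov K i i = 2 * (K : ℝ) := by
    rw [Finset.sum_congr rfl fun i hi => by rw [testCov_self hK (Finset.mem_range.mp hi)]]
    rw [Finset.sum_const, Finset.card_range, nsmul_eq_mul]
    ring
  have s5 : ∑ i ∈ Finset.range K, ∑ j ∈ Finset.range K, 2 * testCov K i j ≤ 4 * K := by
    simp only [← Finset.mul_sum]
    linarith [sum_testCov_le hK]
  rw [s1, s3]
  have b2 : 1 / (K : ℝ) ^ 2 * ∑ i ∈ Finset.range K, ∑ j ∈ Finset.range K,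
      (4 + 8 * testCov K i j ^ 2) ≤ 1 / (K : ℝ) ^ 2 * (4 * K ^ 2 + 16 * K) := by gcongr
  have b5 : 4 * s ^ 2 / K ^ 2 * ∑ i ∈ Finset.range K, ∑ j ∈ Finset.range K, 2 * testCov K i j
      ≤ 4 * s ^ 2 / K ^ 2 * (4 * K) := by gcongr
  have e : 1 / (s ^ 2 * K) * (12 * K) + (1 / (K : ℝ) ^ 2 * (4 * K ^ 2 + 16 * K) + -4 / K * (2 * K)
      + 4 * 1) + 4 * s ^ 2 / K ^ 2 * (4 * K) = 12 / s ^ 2 + 16 / K + 16 * s ^ 2 / K := by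
    field_simp
    ring
  linarith

end Majorant

section TestProbability

open Matrix WideShape

/-- The factor by which the errors of trace normalisation are multiplied. -/
def errFactor (K i : ℕ) (s : ℝ) : ℝ :=
  4 ^ (testScale K i ^ 2) / testNorm (testScale K i) * (8 * s)

/-- The majorant of the test event for trace-normalised matrices. -/
def normMajorant (K : ℕ) (s : ℝ) : (Σ θ : WideShape, Mat θ × Mat θ) → ℝ :=
  majorant wishartFam K s
    + ∑ i ∈ Finset.range K, (2 * errFactor K i s ^ 2) • copySum (normErr (testScale K i ^ 2) ^ 2)
    + (4 : ℝ) • copySum (traceDev ^ 2)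

lemma normMajorant_apply (K : ℕ) (s : ℝ) (p : Σ θ : WideShape, Mat θ × Mat θ) :
    normMajorant K s p = majorant wishartFam K s p
      + ∑ i ∈ Finset.range K, (2 * errFactor K i s ^ 2) *
        (normErr (testScale K i ^ 2) ⟨p.1, p.2.1⟩ ^ 2
          + normErr (testScale K i ^ 2) ⟨p.1, p.2.2⟩ ^ 2)
      + 4 * (traceDev ⟨p.1, p.2.1⟩ ^ 2 + traceDev ⟨p.1, p.2.2⟩ ^ 2) := by
  simp only [normMajorant, copySum, Pi.add_apply, Pi.smul_apply, Pi.pow_apply, smul_eq_mul,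
    Finset.sum_apply]

lemma normMajorant_nonneg (K : ℕ) (s : ℝ) (p : Σ θ : WideShape, Mat θ × Mat θ) :
    0 ≤ normMajorant K s p := by
  have := majorant_nonneg (Y := wishartFam) K s p
  rw [normMajorant_apply]
  positivity

/-- The pair of trace-normalised Wishart matrices generated by a pair of rectangular matrices. -/
def wishartPair {n m : ℕ} (q : Matrix (Fin n) (Fin m) ℂ × Matrix (Fin n) (Fin m) ℂ) :
    Matrix (Fin n) (Fin n) ℂ × Matrix (Fin n) (Fin n) ℂ :=
  (traceNorm (q.1 * q.1ᴴ), traceNorm (q.2 * q.2ᴴ))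

/-- The event that every test statistic of the second matrix is dominated by that of the first. -/
def testEvent (K n m : ℕ) :
    Set (Matrix (Fin n) (Fin n) ℂ × Matrix (Fin n) (Fin n) ℂ) :=
  {p | trace p.1 = 1 → trace p.2 = 1 → ∀ i < K,
    testStat (specScale n m) (specShift n m) (testScale K i ^ 2) p.2
    ≤ testStat (specScale n m) (specShift n m) (testScale K i ^ 2) p.1}

lemma trace_traceNorm {p : Σ θ : WideShape, Mat θ} (h : |traceDev p| ≤ 1 / 2) :
    trace (traceNorm (p.2 * p.2ᴴ)) = 1 := by
  have key := trace_mul_conjTranspose_eq p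
  have hD := one_add_ratio_mul_traceDev_ge h
  have hr := p.1.ratio_pos
  have hn := p.1.cast_fst_pos
  rw [traceNorm, trace_smul, smul_eq_mul]
  refine inv_mul_cancel₀ fun h0 => ?_
  rw [h0, zero_mul] at key
  have : 0 < (p.1.1.1 / ratio p.1 : ℝ) * (1 + ratio p.1 * traceDev p) :=
    mul_pos (div_pos hn hr) (by linarith)
  exact this.ne (by exact_mod_cast key)

lemma mul_abs_add_mul_abs_le {Q ν s x y : ℝ} (hQ : 0 < Q) (hν : 0 < ν) (hs : 0 < s)
    (h : 2 * (Q / ν * (8 * s)) ^ 2 * (x ^ 2 + y ^ 2) ≤ 1) :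
    Q * |x| + Q * |y| ≤ ν * (1 / (8 * s)) := by
  have e : Q / ν * (8 * s) * (|x| + |y|) ≤ 1 := by
    refine abs_le_of_sq_le_sq' ?_ zero_le_one |>.2
    have : (|x| + |y|) ^ 2 ≤ 2 * (x ^ 2 + y ^ 2) := by
      rw [← sq_abs x, ← sq_abs y]
      nlinarith [sq_nonneg (|x| - |y|)]
    calc (Q / ν * (8 * s) * (|x| + |y|)) ^ 2
        = (Q / ν * (8 * s)) ^ 2 * (|x| + |y|) ^ 2 := by ring
      _ ≤ (Q / ν * (8 * s)) ^ 2 * (2 * (x ^ 2 + y ^ 2)) := by gcongr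
      _ ≤ 1 ^ 2 := by linarith
  have : Q / ν * (8 * s) * (|x| + |y|) = (Q * |x| + Q * |y|) / (ν * (1 / (8 * s))) := by
    field_simp
  rwa [this, div_le_one (by positivity)] at e

lemma neg_le_copyDiff_testFam {K i : ℕ} (hi : i < K) {s : ℝ} (hs : 0 < s)
    {θ : WideShape} {G H : Mat θ} (hG : |traceDev ⟨θ, G⟩| ≤ 1 / 2) (hH : |traceDev ⟨θ, H⟩| ≤ 1 / 2)
    (herr : (2 * errFactor K i s ^ 2) * (normErr (testScale K i ^ 2) ⟨θ, G⟩ ^ 2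
      + normErr (testScale K i ^ 2) ⟨θ, H⟩ ^ 2) ≤ 1)
    (h : testStat (specScale θ.1.1 θ.1.2) (specShift θ.1.1 θ.1.2) (testScale K i ^ 2)
        (traceNorm (H * Hᴴ))
      ≤ testStat (specScale θ.1.1 θ.1.2) (specShift θ.1.1 θ.1.2) (testScale K i ^ 2)
        (traceNorm (G * Gᴴ))) :
    -(1 / (8 * s)) ≤ copyDiff (testFam wishartFam K i) ⟨θ, G, H⟩ := by
  have hK : 0 < K := by omega
  have hν := testNorm_pos (testScale_pos hK i)
  have c1 := abs_testStat_traceNorm_sub_le hG (testScale K i ^ 2)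
  have c2 := abs_testStat_traceNorm_sub_le hH (testScale K i ^ 2)
  rw [powTrace_two_mul_sq (testScale_pos hK i) (testScale_sq_le hK hi)] at c1 c2
  have e := mul_abs_add_mul_abs_le (by positivity) hν hs herr
  refine le_of_mul_le_mul_left ?_ hν
  rw [copyDiff, testFam, mul_sub, mul_neg]
  linarith [(abs_le.mp c1).2, (abs_le.mp c2).1]

lemma one_le_normMajorant {K : ℕ} (hK : 0 < K) {s : ℝ} (hs : 0 < s)
    {θ : WideShape} {G H : Mat θ} (h : wishartPair (G, H) ∈ testEvent K θ.1.1 θ.1.2) :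
    1 ≤ normMajorant K s ⟨θ, G, H⟩ := by
  by_contra! hlt
  rw [normMajorant_apply] at hlt
  have h1 := majorant_nonneg (Y := wishartFam) K s ⟨θ, G, H⟩
  have h2 : ∀ i ∈ Finset.range K, 0 ≤ (2 * errFactor K i s ^ 2) *
        (normErr (testScale K i ^ 2) ⟨θ, G⟩ ^ 2
          + normErr (testScale K i ^ 2) ⟨θ, H⟩ ^ 2) := fun i _ => by positivity
  have h2' := Finset.sum_nonneg h2
  have hx := sq_nonneg (traceDev ⟨θ, G⟩)
  have hy := sq_nonneg (traceDev ⟨θ, H⟩)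
  have d1 : |traceDev ⟨θ, G⟩| ≤ 1 / 2 := abs_le_of_sq_le_sq (by linarith) (by norm_num)
  have d2 : |traceDev ⟨θ, H⟩| ≤ 1 / 2 := abs_le_of_sq_le_sq (by linarith) (by norm_num)
  have t1 : trace (wishartPair (G, H)).1 = 1 := trace_traceNorm (p := ⟨θ, G⟩) d1
  have t2 : trace (wishartPair (G, H)).2 = 1 := trace_traceNorm (p := ⟨θ, H⟩) d2
  have h4 := one_le_majorant (Y := wishartFam) hK hs (p := ⟨θ, G, H⟩) fun i hi =>
    neg_le_copyDiff_testFam hi hs d1 d2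
      ((Finset.single_le_sum h2 (Finset.mem_range.mpr hi)).trans (by linarith))
      (h t1 t2 i hi)
  linarith

lemma meanTendsto_normErr_sq {P : ℕ} (hP : P ≠ 0) {l : Filter WideShape}
    (hl : Tendsto invDim l (𝓝 0)) : MeanTendsto gauss l (normErr P ^ 2) 0 := by
  refine schwingerDysonFamily_wishartFam.meanTendsto_sq_zero hl (dim_mul_normErr_mem hP) ?_
  ext p
  have := p.1.cast_fst_pos.ne'
  rw [Pi.mul_apply, ofParam_apply, invDim]
  field_simp

lemma meanTendsto_traceDev_sq {l : Filter WideShape} (hl : Tendsto invDim l (𝓝 0)) :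
    MeanTendsto gauss l (traceDev ^ 2) 0 :=
  schwingerDysonFamily_wishartFam.meanTendsto_sq_zero hl (self_mem_polyAlg 1) rfl

lemma exists_meanTendsto_normMajorant {l : Filter WideShape} (hl : Tendsto invDim l (𝓝 0))
    {K : ℕ} (hK : 0 < K) {s : ℝ} (hs : 0 < s) :
    ∃ x ≤ 12 / s ^ 2 + 16 / K + 16 * s ^ 2 / K,
      MeanTendsto (fun θ => (gauss θ).prod (gauss θ)) l (normMajorant K s) x := by
  obtain ⟨x, hx, h⟩ := schwingerDysonFamily_wishartFam.exists_meanTendsto_majorant hl hK hs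
  refine ⟨x, hx, ?_⟩
  have h1 := MeanTendsto.sum (s := Finset.range K) fun i _ =>
    (meanTendsto_normErr_sq (pow_ne_zero 2 (testScale_pos hK i).ne') hl).copySum.smul
      (2 * errFactor K i s ^ 2)
  have h2 := (meanTendsto_traceDev_sq hl).copySum.smul 4
  simpa [normMajorant] using (h.add h1).add h2

theorem exists_measure_testEvent_le {ε : ℝ} (hε : 0 < ε) :
    ∃ K N : ℕ, ∀ θ : WideShape, N ≤ θ.1.1 →
      ((gauss θ).prod (gauss θ))
        (wishartPair ⁻¹' testEvent K θ.1.1 θ.1.2)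
        ≤ ENNReal.ofReal ε := by
  set s := √(36 / ε) with hs'
  have hs : 0 < s := Real.sqrt_pos.mpr (by positivity)
  have hs2 : s ^ 2 = 36 / ε := Real.sq_sqrt (by positivity)
  obtain ⟨K, hK⟩ := exists_nat_gt ((16 + 16 * s ^ 2) * 3 / ε)
  have hK' : (0 : ℝ) < K := lt_of_le_of_lt (by positivity) hK
  obtain ⟨x, hx, h⟩ := exists_meanTendsto_normMajorant (l := comap invDim (𝓝 0)) tendsto_comap
    (by exact_mod_cast hK' : 0 < K) hs
  have hxε : x < ε := by
    have h1 : 12 / s ^ 2 = ε / 3 := by rw [hs2]; field_simp; norm_num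
    have h2 : 16 / K + 16 * s ^ 2 / K < ε / 3 := by
      rw [← add_div, div_lt_iff₀ hK']
      rw [div_lt_iff₀ hε] at hK
      linarith
    linarith
  have ev := h.tendsto.eventually_lt_const hxε
  obtain ⟨δ, hδ, hball⟩ := Metric.eventually_nhds_iff.mp (eventually_comap.mp ev)
  obtain ⟨N, hN⟩ := exists_nat_gt (1 / δ)
  refine ⟨K, N, fun θ hθ => ?_⟩
  have hint : ∫ q, normMajorant K s ⟨θ, q⟩ ∂(gauss θ).prod (gauss θ) < ε := by
    refine hball ?_ θ rfl
    rw [Real.dist_0_eq_abs, abs_of_pos θ.invDim_pos, invDim, one_div_lt θ.cast_fst_pos hδ]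
    exact hN.trans_le (by exact_mod_cast hθ)
  have hm := mul_meas_ge_le_integral_of_nonneg
    (Eventually.of_forall fun q => normMajorant_nonneg K s ⟨θ, q⟩) (h.integrable θ) 1
  rw [one_mul] at hm
  refine (measure_mono fun q hq => ?_).trans
    ((ENNReal.le_ofReal_iff_toReal_le (measure_ne_top _ _) hε.le).mpr (hm.trans hint.le))
  exact one_le_normMajorant (by exact_mod_cast hK') hs hq

end TestProbability

section Majorisation

open Matrix

lemma tailSum_zero {n : ℕ} (v : Fin (n + 1) → ℝ) : tailSum v 0 = ∑ i, v i := by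
  simp [tailSum]

lemma tailSum_succ {n : ℕ} (v : Fin (n + 1) → ℝ) (k : Fin n) :
    tailSum v k.succ = tailSum (fun i => v i.succ) k := by
  rw [tailSum, tailSum, Finset.sum_filter, Finset.sum_filter, Fin.sum_univ_succ]
  simp

lemma tailSum_sub {n : ℕ} (v w : Fin n → ℝ) (k : Fin n) :
    tailSum (v - w) k = tailSum v k - tailSum w k :=
  Finset.sum_sub_distrib ..

lemma mul_sum_le_of_tailSum_nonpos {n : ℕ} {c d : Fin n → ℝ} (hc : Antitone c)
    (hd : ∀ k, tailSum d k ≤ 0) {b : ℝ} (hb : ∀ i, c i ≤ b) :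
    b * ∑ i, d i ≤ ∑ i, c i * d i := by
  induction n generalizing b with
  | zero => simp
  | succ n ih =>
    have h := ih (c := fun i => c i.succ) (d := fun i => d i.succ)
      (fun i j hij => hc (Fin.succ_le_succ_iff.mpr hij)) (fun k => tailSum_succ d k ▸ hd k.succ)
      (b := c 0) (fun i => hc (Fin.zero_le _))
    have h0 : ∑ i, d i ≤ 0 := tailSum_zero d ▸ hd 0
    rw [Fin.sum_univ_succ] at h0 ⊢
    rw [Fin.sum_univ_succ]
    nlinarith [hb 0]

lemma sum_mul_nonneg_of_tailSum_nonpos {n : ℕ} {c d : Fin n → ℝ} (hc : Antitone c)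
    (hd : ∀ k, tailSum d k ≤ 0) (h0 : ∑ i, d i = 0) : 0 ≤ ∑ i, c i * d i := by
  cases n with
  | zero => simp
  | succ n =>
    simpa [h0] using mul_sum_le_of_tailSum_nonpos hc hd fun i => hc (Fin.zero_le i)

lemma two_mul_pow_mul_sub_le (P : ℕ) (a b : ℝ) :
    (2 * P : ℕ) * b ^ (2 * P - 1) * (a - b) ≤ a ^ (2 * P) - b ^ (2 * P) := by
  have hc := (even_two_mul P).convexOn_pow (𝕜 := ℝ)
  have hd := hasDerivAt_pow (2 * P) b
  rcases lt_trichotomy a b with h | rfl | h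
  · have := hc.slope_le_of_hasDerivAt (Set.mem_univ a) (Set.mem_univ b) h hd
    rw [slope_def_field, div_le_iff₀ (by linarith)] at this
    linarith
  · simp
  · have := hc.le_slope_of_hasDerivAt (Set.mem_univ b) (Set.mem_univ a) h hd
    rwa [slope_def_field, le_div_iff₀ (by linarith)] at this

lemma sum_pow_le_of_tailSum_le {n : ℕ} {v w : Fin n → ℝ} (hw : Antitone w)
    (h : ∀ k, tailSum v k ≤ tailSum w k) (h0 : ∑ i, v i = ∑ i, w i) {N : ℝ} (hN : 0 ≤ N)
    (s : ℝ) {P : ℕ} (hP : P ≠ 0) :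
    ∑ i, (N * w i - s) ^ (2 * P) ≤ ∑ i, (N * v i - s) ^ (2 * P) := by
  have hodd : Odd (2 * P - 1) := ⟨P - 1, by omega⟩
  have key := sum_mul_nonneg_of_tailSum_nonpos
    (c := fun i => (2 * P : ℕ) * (N * w i - s) ^ (2 * P - 1) * N) (d := v - w)
    (fun i j hij => by
      have : (N * w j - s) ^ (2 * P - 1) ≤ (N * w i - s) ^ (2 * P - 1) :=
        hodd.strictMono_pow.monotone (by gcongr; exact hw hij)
      simp only
      gcongr)
    (fun k => by rw [tailSum_sub]; linarith [h k])
    (by simp [h0])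
  rw [← sub_nonneg, ← Finset.sum_sub_distrib]
  refine key.trans (Finset.sum_le_sum fun i _ => ?_)
  refine le_trans (le_of_eq ?_) (two_mul_pow_mul_sub_le P (N * v i - s) (N * w i - s))
  rw [Pi.sub_apply]
  ring

lemma antitone_sortDesc {n : ℕ} (v : Fin n → ℝ) : Antitone (sortDesc v) :=
  fun _ _ h => Tuple.monotone_sort v (Fin.rev_le_rev.mpr h)

lemma sum_comp_sortDesc {n : ℕ} (f : ℝ → ℝ) (v : Fin n → ℝ) :
    ∑ i, f (sortDesc v i) = ∑ i, f (v i) :=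
  Equiv.sum_comp (Fin.revPerm.trans (Tuple.sort v)) fun i => f (v i)

lemma testStat_eq_sum_eigenvalues {n : ℕ} {A : Matrix (Fin n) (Fin n) ℂ} (hA : A.IsHermitian)
    (N s : ℝ) (P : ℕ) : testStat N s P A = ∑ i, (N * hA.eigenvalues i - s) ^ (2 * P) := by
  have h : ((N : ℂ) • A - (s : ℂ) • 1) ^ (2 * P)
      = Unitary.conjStarAlgAut ℂ _ hA.eigenvectorUnitary
        (diagonal fun i => (((N * hA.eigenvalues i - s) ^ (2 * P) : ℝ) : ℂ)) := by
    have e : (diagonal fun i => (((N * hA.eigenvalues i - s) ^ (2 * P) : ℝ) : ℂ))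
        = ((N : ℂ) • diagonal (RCLike.ofReal ∘ hA.eigenvalues) - (s : ℂ) • 1) ^ (2 * P) := by
      rw [← diagonal_one, ← diagonal_smul, ← diagonal_smul, diagonal_sub, diagonal_pow]
      congr 1
      ext i
      simp
    rw [e, map_pow, map_sub, map_smul, map_smul, map_one, ← hA.spectral_theorem]
  rw [testStat, h, Unitary.conjStarAlgAut_apply, trace_mul_cycle, Unitary.coe_star_mul_self,
    one_mul, trace_diagonal, ← Complex.ofReal_sum, Complex.ofReal_re]

lemma testStat_le_of_tailSum_le {n : ℕ} {A B : Matrix (Fin n) (Fin n) ℂ} (hA : A.IsHermitian)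
    (hB : B.IsHermitian) (hAB : trace A = trace B)
    (h : ∀ k, tailSum (eigsDesc A) k ≤ tailSum (eigsDesc B) k) {N : ℝ} (hN : 0 ≤ N) (s : ℝ)
    {P : ℕ} (hP : P ≠ 0) : testStat N s P B ≤ testStat N s P A := by
  have eA : eigs A = hA.eigenvalues := dif_pos hA
  have eB : eigs B = hB.eigenvalues := dif_pos hB
  rw [hA.trace_eq_sum_eigenvalues, hB.trace_eq_sum_eigenvalues] at hAB
  rw [testStat_eq_sum_eigenvalues hA, testStat_eq_sum_eigenvalues hB, ← eA, ← eB,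
    ← sum_comp_sortDesc (fun x => (N * x - s) ^ (2 * P)) (eigs A),
    ← sum_comp_sortDesc (fun x => (N * x - s) ^ (2 * P)) (eigs B)]
  refine sum_pow_le_of_tailSum_le (antitone_sortDesc _) h ?_ hN s hP
  change ∑ i, sortDesc (eigs A) i = ∑ i, sortDesc (eigs B) i
  rw [sum_comp_sortDesc (fun x => x), sum_comp_sortDesc (fun x => x), eA, eB]
  exact_mod_cast hAB

end Majorisation

section Transposition

open Matrix WideShape

lemma sub_smul_one_pow_mul_comm {n m : ℕ} (A : Matrix (Fin n) (Fin m) ℂ)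
    (B : Matrix (Fin m) (Fin n) ℂ) (c s : ℂ) (q : ℕ) :
    (c • (A * B) - s • 1) ^ q * A = A * (c • (B * A) - s • 1) ^ q := by
  induction q with
  | zero => simp
  | succ q ih =>
    have h : (c • (A * B) - s • 1) * A = A * (c • (B * A) - s • 1) := by
      simp [Matrix.sub_mul, Matrix.mul_sub, Matrix.mul_assoc]
    rw [pow_succ, Matrix.mul_assoc, h, ← Matrix.mul_assoc, ih, Matrix.mul_assoc, ← pow_succ]

lemma trace_sub_smul_one_pow_mul_comm {n m : ℕ} (A : Matrix (Fin n) (Fin m) ℂ)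
    (B : Matrix (Fin m) (Fin n) ℂ) (c s : ℂ) (q : ℕ) :
    trace ((c • (A * B) - s • 1) ^ q) - trace ((c • (B * A) - s • 1) ^ q)
      = (-s) ^ q * (n - m) := by
  induction q with
  | zero => simp
  | succ q ih =>
    have h : trace ((c • (A * B) - s • 1) ^ q * (A * B))
        = trace ((c • (B * A) - s • 1) ^ q * (B * A)) := by
      rw [← Matrix.mul_assoc, sub_smul_one_pow_mul_comm, trace_mul_comm, ← Matrix.mul_assoc,
        trace_mul_comm]
    rw [pow_succ, pow_succ (c • (B * A) - s • 1), Matrix.mul_sub, Matrix.mul_sub, trace_sub,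
      trace_sub, Matrix.mul_smul, Matrix.mul_smul, Matrix.mul_smul, Matrix.mul_smul, Matrix.mul_one,
      Matrix.mul_one, trace_smul, trace_smul, trace_smul, trace_smul, h,
      pow_succ]
    simp only [smul_eq_mul]
    linear_combination -s * ih

lemma trace_transpose_mul_conjTranspose {n m : ℕ} (G : Matrix (Fin n) (Fin m) ℂ) :
    trace (Gᵀ * Gᵀᴴ) = trace (G * Gᴴ) := by
  rw [← trace_transpose, transpose_mul, trace_mul_comm]
  rfl

lemma testStat_traceNorm_transpose {n m : ℕ} (G : Matrix (Fin n) (Fin m) ℂ) (N s : ℝ) (P : ℕ) :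
    testStat N s P (traceNorm (Gᵀ * Gᵀᴴ))
      = testStat N s P (traceNorm (G * Gᴴ)) - s ^ (2 * P) * (n - m) := by
  have h := trace_sub_smul_one_pow_mul_comm G Gᴴ (N * (trace (G * Gᴴ))⁻¹) s (2 * P)
  have e : (((N : ℂ) * (trace (G * Gᴴ))⁻¹) • (Gᴴ * G) - (s : ℂ) • 1)ᵀ
      = (N : ℂ) • traceNorm (Gᵀ * Gᵀᴴ) - (s : ℂ) • 1 := by
    rw [traceNorm, trace_transpose_mul_conjTranspose, smul_smul, transpose_sub, transpose_smul,
      transpose_smul, transpose_mul, transpose_one]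
    rfl
  rw [← trace_transpose (((_ : ℂ) • (Gᴴ * G) - _) ^ _), transpose_pow, e, ← smul_smul] at h
  have h' := congrArg Complex.re h
  rw [Complex.sub_re, (even_two_mul P).neg_pow] at h'
  have h'' : ((s : ℂ) ^ (2 * P) * (n - m)).re = s ^ (2 * P) * (n - m) := by
    rw [← Complex.ofReal_re (s ^ (2 * P) * (n - m))]
    push_cast
    rfl
  rw [h''] at h'
  rw [testStat, testStat, traceNorm, traceNorm] at *
  linarith

lemma specScale_comm (n m : ℕ) : specScale n m = specScale m n := by
  rw [specScale, specScale, mul_comm]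

lemma specShift_comm (n m : ℕ) : specShift n m = specShift m n := by
  rw [specShift, specShift, add_comm]

lemma wishartPair_transpose_mem_testEvent {K n m : ℕ}
    (q : Matrix (Fin n) (Fin m) ℂ × Matrix (Fin n) (Fin m) ℂ) :
    wishartPair (q.1ᵀ, q.2ᵀ) ∈ testEvent K m n ↔ wishartPair q ∈ testEvent K n m := by
  have h (G : Matrix (Fin n) (Fin m) ℂ) :
      trace (traceNorm (Gᵀ * Gᵀᴴ)) = trace (traceNorm (G * Gᴴ)) := by
    rw [traceNorm, traceNorm, trace_smul, trace_smul, trace_transpose_mul_conjTranspose]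
  simp only [testEvent, wishartPair, Set.mem_ofPred_eq, testStat_traceNorm_transpose,
    specScale_comm m n, specShift_comm m n, sub_le_sub_iff_right, h]

lemma map_swap_pi_pi {ι κ α : Type*} [Fintype ι] [Fintype κ] [MeasurableSpace α]
    (ν : Measure α) [SigmaFinite ν] :
    (Measure.pi fun _ : ι => Measure.pi fun _ : κ => ν).map Function.swap
      = Measure.pi fun _ : κ => Measure.pi fun _ : ι => ν := by
  have hm : Measurable fun (G : ι → κ → α) => Function.swap G :=
    measurable_pi_iff.mpr fun j => measurable_pi_iff.mpr fun i =>
      (measurable_pi_apply j).comp (measurable_pi_apply i)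
  refine (Measure.pi_eq_generateFrom (fun _ => generateFrom_pi) (fun _ => isPiSystem_pi)
    (fun _ => Measure.FiniteSpanningSetsIn.pi fun _ => ν.toFiniteSpanningSetsIn)
    fun s hs => ?_).symm
  choose t ht hts using hs
  obtain rfl : (fun j => Set.univ.pi (t j)) = s := funext hts
  have hmeas : MeasurableSet (Set.univ.pi fun j => Set.univ.pi (t j)) :=
    MeasurableSet.univ_pi fun j => MeasurableSet.univ_pi fun i => ht j i (Set.mem_univ i)
  have hpre : Function.swap ⁻¹' (Set.univ.pi fun j => Set.univ.pi (t j))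
      = Set.univ.pi fun i => Set.univ.pi fun j => t j i := by
    ext G
    simp only [Set.mem_preimage, Set.mem_univ_pi]
    exact forall_comm
  rw [Measure.map_apply hm hmeas, hpre]
  simp only [Measure.pi_pi]
  exact Finset.prod_comm

lemma gaussMatrix_map_transpose (n m : ℕ) :
    (gaussMatrix n m).map transpose = gaussMatrix m n :=
  map_swap_pi_pi stdCGaussian

end Transposition

section Measurability

open Matrix

variable {α : Type*} [MeasurableSpace α] {n m : ℕ}

lemma measurable_matrix_iff {f : α → Matrix (Fin n) (Fin m) ℂ} :
    Measurable f ↔ ∀ i j, Measurable fun x => f x i j :=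
  measurable_pi_iff.trans (forall_congr' fun _ => measurable_pi_iff)

lemma measurable_trace {f : α → Matrix (Fin n) (Fin n) ℂ} (hf : Measurable f) :
    Measurable fun x => trace (f x) :=
  Finset.measurable_sum _ fun i _ => measurable_matrix_iff.mp hf i i

lemma measurable_matrix_smul {c : α → ℂ} {f : α → Matrix (Fin n) (Fin n) ℂ} (hc : Measurable c)
    (hf : Measurable f) : Measurable fun x => c x • f x :=
  measurable_matrix_iff.mpr fun i j => hc.mul (measurable_matrix_iff.mp hf i j)

lemma measurable_matrix_mul {l : ℕ} {f : α → Matrix (Fin n) (Fin m) ℂ}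
    {g : α → Matrix (Fin m) (Fin l) ℂ} (hf : Measurable f) (hg : Measurable g) :
    Measurable fun x => f x * g x :=
  measurable_matrix_iff.mpr fun i j => by
    simp only [mul_apply]
    exact Finset.measurable_sum _ fun k _ =>
      (measurable_matrix_iff.mp hf i k).mul (measurable_matrix_iff.mp hg k j)

lemma measurable_matrix_pow {f : α → Matrix (Fin n) (Fin n) ℂ} (hf : Measurable f) (q : ℕ) :
    Measurable fun x => f x ^ q := by
  induction q with
  | zero => simp
  | succ q ih => simpa only [pow_succ] using measurable_matrix_mul ih hf

lemma measurable_mul_conjTranspose :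
    Measurable fun G : Matrix (Fin n) (Fin m) ℂ => G * Gᴴ :=
  measurable_matrix_mul measurable_id <| measurable_matrix_iff.mpr fun i j =>
    Complex.continuous_conj.measurable.comp (measurable_matrix_iff.mp measurable_id j i)

lemma measurable_traceNorm : Measurable (traceNorm (n := n)) :=
  measurable_matrix_smul (measurable_trace measurable_id).inv measurable_id

lemma measurable_transpose :
    Measurable (transpose : Matrix (Fin n) (Fin m) ℂ → Matrix (Fin m) (Fin n) ℂ) :=
  measurable_matrix_iff.mpr fun i j => measurable_matrix_iff.mp measurable_id j i

lemma measurable_testStat (N s : ℝ) (P : ℕ) : Measurable (testStat (n := n) N s P) :=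
  Complex.measurable_re.comp <| measurable_trace <| measurable_matrix_pow
    (measurable_matrix_iff.mpr fun i j =>
      ((measurable_matrix_iff.mp measurable_id i j).const_mul (N : ℂ)).sub_const
        (((s : ℂ) • (1 : Matrix (Fin n) (Fin n) ℂ)) i j)) _

lemma measurable_wishartPair : Measurable (wishartPair (n := n) (m := m)) :=
  (measurable_traceNorm.comp (measurable_mul_conjTranspose.comp measurable_fst)).prodMk
    (measurable_traceNorm.comp (measurable_mul_conjTranspose.comp measurable_snd))

lemma measurableSet_isHermitian : MeasurableSet {M : Matrix (Fin n) (Fin n) ℂ | M.IsHermitian} := by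
  simp only [IsHermitian.ext_iff, Set.ofPred_forall]
  exact MeasurableSet.iInter fun i => MeasurableSet.iInter fun j => measurableSet_eq_fun
    (Complex.continuous_conj.measurable.comp (measurable_matrix_iff.mp measurable_id j i))
    (measurable_matrix_iff.mp measurable_id i j)

lemma measurableSet_testEvent (K n m : ℕ) : MeasurableSet (testEvent K n m) := by
  have h1 : MeasurableSet {M : Matrix (Fin n) (Fin n) ℂ | trace M = 1} :=
    measurableSet_eq_fun (measurable_trace measurable_id) measurable_const
  refine measurableSet_setOfPred.mpr ?_
  refine (measurableSet_setOfPred.mp (measurable_fst h1)).imp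
    ((measurableSet_setOfPred.mp (measurable_snd h1)).imp
      (Measurable.forall fun i => measurable_const.imp ?_))
  exact measurableSet_setOfPred.mp <| measurableSet_le
    ((measurable_testStat _ _ _).comp measurable_snd)
    ((measurable_testStat _ _ _).comp measurable_fst)

end Measurability

section Conclusion

open Matrix

lemma wishartNorm_eq_map (n m : ℕ) :
    wishartNorm n m = (gaussMatrix n m).map fun G => traceNorm (G * Gᴴ) :=
  Measure.map_map measurable_traceNorm measurable_mul_conjTranspose

lemma wishartNorm_prod_eq_map (n m : ℕ) :
    (wishartNorm n m).prod (wishartNorm n m)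
      = ((gaussMatrix n m).prod (gaussMatrix n m)).map wishartPair := by
  have h := measurable_traceNorm.comp (measurable_mul_conjTranspose (n := n) (m := m))
  rw [wishartNorm_eq_map]
  exact Measure.map_prod_map _ _ h h

lemma isHermitian_traceNorm {n : ℕ} {M : Matrix (Fin n) (Fin n) ℂ} (hM : M.IsHermitian) :
    (traceNorm M).IsHermitian := by
  rw [IsHermitian, traceNorm, conjTranspose_smul, star_inv₀, ← trace_conjTranspose, hM.eq]

lemma gaussMatrix_prod_testEvent_comm (K n m : ℕ) :
    ((gaussMatrix m n).prod (gaussMatrix m n)) (wishartPair ⁻¹' testEvent K m n)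
      = ((gaussMatrix n m).prod (gaussMatrix n m)) (wishartPair ⁻¹' testEvent K n m) := by
  rw [← gaussMatrix_map_transpose n m,
    Measure.map_prod_map _ _ measurable_transpose measurable_transpose,
    Measure.map_apply (measurable_transpose.prodMap measurable_transpose)
      (measurable_wishartPair (measurableSet_testEvent K m n))]
  exact congrArg _ (Set.ext fun q => wishartPair_transpose_mem_testEvent q)

lemma wishartNorm_prod_tailSum_le {n m : ℕ} (K : ℕ) :
    ((wishartNorm n m).prod (wishartNorm n m))
        {p | ∀ k : Fin n, tailSum (eigsDesc p.1) k ≤ tailSum (eigsDesc p.2) k}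
      ≤ ((gaussMatrix n m).prod (gaussMatrix n m)) (wishartPair ⁻¹' testEvent K n m) := by
  set H : Set (Matrix (Fin n) (Fin n) ℂ) := {M | M.IsHermitian}
  have hH : MeasurableSet H := measurableSet_isHermitian
  have hS : MeasurableSet ((H ×ˢ H)ᶜ ∪ testEvent K n m) :=
    (hH.prod hH).compl.union (measurableSet_testEvent K n m)
  refine (measure_mono (t := (H ×ˢ H)ᶜ ∪ testEvent K n m) fun p hp => ?_).trans ?_
  · by_cases h : p ∈ H ×ˢ H
    · exact Or.inr fun h1 h2 i hi => testStat_le_of_tailSum_le h.1 h.2 (h1.trans h2.symm) hp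
        (Real.sqrt_nonneg _) _ (pow_ne_zero 2 (testScale_pos (by omega) i).ne')
    · exact Or.inl h
  · rw [wishartNorm_prod_eq_map, Measure.map_apply measurable_wishartPair hS]
    refine measure_mono fun q hq => hq.resolve_left fun h => h ⟨?_, ?_⟩
    all_goals exact isHermitian_traceNorm (isHermitian_mul_conjTranspose_self _)

end Conclusion

/-- **Nielsen's conjecture** (Theorem 1 of the paper).  For independent samples from the
trace-normalised complex Wishart--Laguerre ensemble, the probability that the spectrum of the
second majorises the spectrum of the first tends to `0` as `n, m → ∞`. -/
theorem nielsen_conjecture (ε : ℝ) (hε : 0 < ε) :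
    ∃ N : ℕ, ∀ n m : ℕ, N ≤ n → N ≤ m →
      ((wishartNorm n m).prod (wishartNorm n m))
          {p | ∀ k : Fin n, tailSum (eigsDesc p.1) k ≤ tailSum (eigsDesc p.2) k}
        ≤ ENNReal.ofReal ε := by
  obtain ⟨K, N, h⟩ := exists_measure_testEvent_le hε
  refine ⟨max N 1, fun n m hn hm => (wishartNorm_prod_tailSum_le K).trans ?_⟩
  rw [max_le_iff] at hn hm
  rcases le_total n m with hnm | hnm
  · exact h ⟨(n, m), hn.2, hnm⟩ hn.1
  · rw [← gaussMatrix_prod_testEvent_comm]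
    exact h ⟨(m, n), hm.2, hnm⟩ hm.1
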